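/- arXiv:2508.15573 — 6 statements merged into one kernel-verified Lean document; each statement's English description precedes it below -/
import Mathlib

section
/- Let $\mathfrak{g}$ be a finite-dimensional complex simple Lie algebra. Then every derivation of the affine-Virasoro Lie algebra $\mathfrak{L}(\mathfrak{g})$ is inner: $\mathrm{Der}(\mathfrak{L}(\mathfrak{g})) = \mathrm{Inn}(\mathfrak{L}(\mathfrak{g}))$. -/
/-- The affine-Virasoro Lie algebra structure: `L` is the affine-Virasoro Lie algebra
associated with the Lie algebra `g`, with `E m x` playing the role of `x ⊗ tᵐ`,
`d m` the Virasoro generators, and central elements `K₁, K₂`. -/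
structure AffineVirasoro (g L : Type*) [LieRing g] [LieAlgebra ℂ g]
    [LieRing L] [LieAlgebra ℂ L] where
  E : ℤ → g →ₗ[ℂ] L
  d : ℤ → L
  K₁ : L
  K₂ : L
  bracket_EE : ∀ (m n : ℤ) (x y : g), ⁅E m x, E n y⁆ =
    E (m + n) ⁅x, y⁆ + (if m + n = 0 then ((m : ℂ) * killingForm ℂ g x y) • K₁ else 0)
  bracket_dE : ∀ (m n : ℤ) (x : g), ⁅d m, E n x⁆ = (n : ℂ) • E (m + n) x
  bracket_dd : ∀ m n : ℤ, ⁅d m, d n⁆ =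
    ((n : ℂ) - (m : ℂ)) • d (m + n) +
      (if m + n = 0 then (((m : ℂ) ^ 3 - (m : ℂ)) / 12) • K₂ else 0)
  central_K₁ : ∀ v : L, ⁅v, K₁⁆ = 0
  central_K₂ : ∀ v : L, ⁅v, K₂⁆ = 0
  spans : Submodule.span ℂ
    (({K₁, K₂} : Set L) ∪ Set.range d ∪ ⋃ m : ℤ, Set.range (E m)) = ⊤
  indep : ∀ (f : ℤ →₀ g) (c : ℤ →₀ ℂ) (a b : ℂ),
    ((f.sum fun m x => E m x) + (c.sum fun m t => t • d m) + a • K₁ + b • K₂ = 0) →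
    f = 0 ∧ c = 0 ∧ a = 0 ∧ b = 0

/-- The degree-`n` graded component `L(g)ₙ` of the affine-Virasoro Lie algebra. -/
def AffineVirasoro.graded {g L : Type*} [LieRing g] [LieAlgebra ℂ g]
    [LieRing L] [LieAlgebra ℂ L] (V : AffineVirasoro g L) (n : ℤ) : Submodule ℂ L :=
  if n = 0 then
    Submodule.span ℂ (Set.range (V.E 0) ∪ {V.d 0, V.K₁, V.K₂})
  else
    Submodule.span ℂ (Set.range (V.E n) ∪ {V.d n})

/-- The degree-`n` component `g̃ₙ` of the ideal `g̃ = ĝ ⊕ ℂK₁`. -/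
def AffineVirasoro.gtilde {g L : Type*} [LieRing g] [LieAlgebra ℂ g]
    [LieRing L] [LieAlgebra ℂ L] (V : AffineVirasoro g L) (n : ℤ) : Submodule ℂ L :=
  if n = 0 then
    Submodule.span ℂ (Set.range (V.E 0) ∪ {V.K₁})
  else
    Submodule.span ℂ (Set.range (V.E n))

section GLemmas

variable {g : Type*} [LieRing g] [LieAlgebra ℂ g] [LieAlgebra.IsSimple ℂ g]

theorem av_center_zero (x : g) (h : ∀ y : g, ⁅x, y⁆ = 0) : x = 0 := by
  have hx : x ∈ LieAlgebra.center ℂ g := by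
    rw [LieModule.mem_maxTrivSubmodule]
    intro y
    rw [← lie_skew, h y, neg_zero]
  rcases LieAlgebra.IsSimple.eq_bot_or_eq_top (R := ℂ) (LieAlgebra.center ℂ g) with h0 | h0
  · rw [h0] at hx
    simpa using hx
  · exact absurd ((LieAlgebra.isLieAbelian_iff_center_eq_top ℂ g).2 h0)
      (LieAlgebra.IsSimple.non_abelian ℂ)

theorem av_perfect {W : Type*} [AddCommGroup W] [Module ℂ W] (f : g →ₗ[ℂ] W)
    (h : ∀ x y : g, f ⁅x, y⁆ = 0) (x : g) : f x = 0 := by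
  let I : LieIdeal ℂ g := ⁅(⊤ : LieIdeal ℂ g), (⊤ : LieIdeal ℂ g)⁆
  have hI : I.toSubmodule ≤ LinearMap.ker f := by
    change (⁅(⊤ : LieIdeal ℂ g), (⊤ : LieIdeal ℂ g)⁆ : LieIdeal ℂ g).toSubmodule ≤ _
    rw [LieSubmodule.lieIdeal_oper_eq_linear_span', Submodule.span_le]
    rintro _ ⟨a, -, b, -, rfl⟩
    exact h a b
  rcases LieAlgebra.IsSimple.eq_bot_or_eq_top (R := ℂ) I with h0 | h0
  · exfalso
    apply LieAlgebra.IsSimple.non_abelian ℂ (L := g)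
    refine ⟨fun a b => ?_⟩
    have : ⁅a, b⁆ ∈ I := LieSubmodule.lie_mem_lie (LieSubmodule.mem_top a) (LieSubmodule.mem_top b)
    rw [h0] at this
    simpa using this
  · have : x ∈ I := by rw [h0]; exact LieSubmodule.mem_top x
    exact hI this

theorem av_exists_lie : ∃ x y : g, ⁅x, y⁆ ≠ 0 := by
  by_contra! h
  exact LieAlgebra.IsSimple.non_abelian ℂ (L := g) ⟨h⟩

theorem av_schur [FiniteDimensional ℂ g] (f : g →ₗ[ℂ] g)
    (h : ∀ x y : g, f ⁅x, y⁆ = ⁅x, f y⁆) : ∃ c : ℂ, ∀ x, f x = c • x := by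
  obtain ⟨a, b, hab⟩ := av_exists_lie (g := g)
  have : Nontrivial g := ⟨⟨_, _, hab⟩⟩
  obtain ⟨c, hc⟩ := Module.End.exists_eigenvalue f
  refine ⟨c, ?_⟩
  let I : LieIdeal ℂ g := { Module.End.eigenspace f c with
    lie_mem := by
      intro x y hy
      have hy' : f y = c • y := Module.End.mem_eigenspace_iff.1 hy
      apply Module.End.mem_eigenspace_iff.2
      rw [h, hy', lie_smul] }
  rcases LieAlgebra.IsSimple.eq_bot_or_eq_top (R := ℂ) I with h0 | h0
  · obtain ⟨v, hv⟩ := hc.exists_hasEigenvector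
    have : v ∈ I := hv.1
    rw [h0] at this
    exact absurd (by simpa using this) hv.2
  · intro x
    have : x ∈ I := by rw [h0]; exact LieSubmodule.mem_top x
    exact Module.End.mem_eigenspace_iff.1 this

theorem av_killing [FiniteDimensional ℂ g] : ∃ x y : g, killingForm ℂ g x y ≠ 0 := by
  by_contra! h
  have hk := LieAlgebra.IsKilling.killingForm_nondegenerate ℂ g
  obtain ⟨a, b, hab⟩ := av_exists_lie (g := g)
  exact hab (hk.1 _ (fun y => h _ y))

theorem av_inner [FiniteDimensional ℂ g] (f : g →ₗ[ℂ] g)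
    (h : ∀ x y : g, f ⁅x, y⁆ = ⁅x, f y⁆ - ⁅y, f x⁆) : ∃ w : g, ∀ x, f x = ⁅w, x⁆ := by
  let D : LieDerivation ℂ g g := ⟨f, h⟩
  have hD : D ∈ (LieDerivation.ad ℂ g).range := by
    rw [LieDerivation.IsKilling.range_ad_eq_top]; trivial
  obtain ⟨w, hw⟩ := hD
  refine ⟨w, fun x => ?_⟩
  have : D x = f x := rfl
  rw [← this, ← hw]
  simp

end GLemmas

namespace AffineVirasoro

variable {g L : Type*} [LieRing g] [LieAlgebra ℂ g] [LieRing L] [LieAlgebra ℂ L]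
  (V : AffineVirasoro g L)

theorem ind {P : L → Prop} (h1 : P V.K₁) (h2 : P V.K₂) (hd : ∀ m, P (V.d m))
    (hE : ∀ m x, P (V.E m x)) (hadd : ∀ u v, P u → P v → P (u + v))
    (hsmul : ∀ (c : ℂ) v, P v → P (c • v)) (v : L) : P v := by
  have hv : v ∈ Submodule.span ℂ
    (({V.K₁, V.K₂} : Set L) ∪ Set.range V.d ∪ ⋃ m : ℤ, Set.range (V.E m)) := by
    rw [V.spans]; trivial
  induction hv using Submodule.span_induction with
  | mem x hx =>
    simp only [Set.mem_union, Set.mem_insert_iff, Set.mem_singleton_iff, Set.mem_range,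
      Set.mem_iUnion] at hx
    rcases hx with ((rfl | rfl) | ⟨m, rfl⟩) | ⟨m, x, rfl⟩
    · exact h1
    · exact h2
    · exact hd m
    · exact hE m x
  | zero => simpa using hsmul 0 _ h1
  | add x y _ _ hx hy => exact hadd _ _ hx hy
  | smul c x _ hx => exact hsmul _ _ hx

noncomputable def T : ((ℤ →₀ g) × (ℤ →₀ ℂ) × ℂ × ℂ) →ₗ[ℂ] L :=
  LinearMap.coprod (Finsupp.lsum ℂ V.E)
    (LinearMap.coprod (Finsupp.lsum ℂ fun m => LinearMap.toSpanSingleton ℂ L (V.d m))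
      (LinearMap.coprod (LinearMap.toSpanSingleton ℂ L V.K₁)
        (LinearMap.toSpanSingleton ℂ L V.K₂)))

theorem T_apply (f : ℤ →₀ g) (c : ℤ →₀ ℂ) (a b : ℂ) : V.T (f, c, a, b) =
    (f.sum fun m x => V.E m x) + (c.sum fun m t => t • V.d m) + a • V.K₁ + b • V.K₂ := by
  simp [T, Finsupp.lsum_apply, add_assoc]
  rfl

theorem T_bij : Function.Bijective V.T := by
  constructor
  · rw [← LinearMap.ker_eq_bot, LinearMap.ker_eq_bot']
    rintro ⟨f, c, a, b⟩ h
    rw [T_apply] at h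
    obtain ⟨rfl, rfl, rfl, rfl⟩ := V.indep _ _ _ _ h
    rfl
  · intro v
    induction v using V.ind with
    | h1 => exact ⟨(0, 0, 1, 0), by simp [T_apply]⟩
    | h2 => exact ⟨(0, 0, 0, 1), by simp [T_apply]⟩
    | hd m => exact ⟨(0, Finsupp.single m 1, 0, 0), by simp [T_apply]⟩
    | hE m x => exact ⟨(Finsupp.single m x, 0, 0, 0), by simp [T_apply]⟩
    | hadd u v hu hv =>
      obtain ⟨a, rfl⟩ := hu
      obtain ⟨b, rfl⟩ := hv
      exact ⟨a + b, map_add _ _ _⟩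
    | hsmul c v hv =>
      obtain ⟨a, rfl⟩ := hv
      exact ⟨c • a, map_smul _ _ _⟩

noncomputable def S : L ≃ₗ[ℂ] ((ℤ →₀ g) × (ℤ →₀ ℂ) × ℂ × ℂ) :=
  (LinearEquiv.ofBijective V.T V.T_bij).symm

theorem S_eq {v : L} {p} (h : V.T p = v) : V.S v = p := by
  rw [S, LinearEquiv.symm_apply_eq]; exact h.symm

theorem S_E (m : ℤ) (x : g) : V.S (V.E m x) = (Finsupp.single m x, 0, 0, 0) :=
  V.S_eq (by simp [T_apply])
theorem S_d (m : ℤ) : V.S (V.d m) = (0, Finsupp.single m 1, 0, 0) :=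
  V.S_eq (by simp [T_apply])
theorem S_K₁ : V.S V.K₁ = (0, 0, 1, 0) := V.S_eq (by simp [T_apply])
theorem S_K₂ : V.S V.K₂ = (0, 0, 0, 1) := V.S_eq (by simp [T_apply])

noncomputable def e (n : ℤ) : L →ₗ[ℂ] g :=
  Finsupp.lapply n ∘ₗ LinearMap.fst ℂ _ _ ∘ₗ V.S.toLinearMap

noncomputable def dl (n : ℤ) : L →ₗ[ℂ] ℂ :=
  Finsupp.lapply n ∘ₗ LinearMap.fst ℂ _ _ ∘ₗ LinearMap.snd ℂ _ _ ∘ₗ V.S.toLinearMap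

@[simp] theorem e_E (n m : ℤ) (x : g) : V.e n (V.E m x) = if m = n then x else 0 := by
  simp [e, S_E, Finsupp.single_apply]
@[simp] theorem e_d (n m : ℤ) : V.e n (V.d m) = 0 := by simp [e, S_d]
@[simp] theorem e_K₁ (n : ℤ) : V.e n V.K₁ = 0 := by simp [e, S_K₁]
@[simp] theorem e_K₂ (n : ℤ) : V.e n V.K₂ = 0 := by simp [e, S_K₂]
@[simp] theorem dl_E (n m : ℤ) (x : g) : V.dl n (V.E m x) = 0 := by simp [dl, S_E]
@[simp] theorem dl_d (n m : ℤ) : V.dl n (V.d m) = if m = n then 1 else 0 := by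
  simp [dl, S_d, Finsupp.single_apply]
@[simp] theorem dl_K₁ (n : ℤ) : V.dl n V.K₁ = 0 := by simp [dl, S_K₁]
@[simp] theorem dl_K₂ (n : ℤ) : V.dl n V.K₂ = 0 := by simp [dl, S_K₂]

theorem K₁_lie (v : L) : ⁅V.K₁, v⁆ = 0 := by rw [← lie_skew, V.central_K₁, neg_zero]
theorem K₂_lie (v : L) : ⁅V.K₂, v⁆ = 0 := by rw [← lie_skew, V.central_K₂, neg_zero]

theorem bracket_Ed (m n : ℤ) (x : g) : ⁅V.E n x, V.d m⁆ = -((n : ℂ) • V.E (m + n) x) := by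
  rw [← lie_skew, V.bracket_dE]

/-- vanishing of non-central coordinates implies central -/
theorem central_of (v : L) (he : ∀ n, V.e n v = 0) (hd : ∀ n, V.dl n v = 0) (w : L) :
    ⁅v, w⁆ = 0 := by
  obtain ⟨⟨f, c, a, b⟩, rfl⟩ := V.T_bij.2 v
  have hS := V.S_eq (rfl : V.T (f, c, a, b) = _)
  have hf : f = 0 := by
    ext n; simpa [e, hS] using he n
  have hc : c = 0 := by
    ext n; simpa [dl, hS] using hd n
  subst hf hc
  simp [T_apply, K₁_lie, K₂_lie]

theorem e_d0 (k : ℤ) (v : L) : V.e k ⁅V.d 0, v⁆ = (k : ℂ) • V.e k v := by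
  induction v using V.ind with
  | h1 => simp [V.central_K₁]
  | h2 => simp [V.central_K₂]
  | hd m => rw [V.bracket_dd]; split_ifs <;> simp
  | hE m x =>
    rw [V.bracket_dE]
    by_cases h : m = k <;> simp [h]
  | hadd u v hu hv => simp [hu, hv]
  | hsmul c v hv => rw [lie_smul, map_smul, hv, map_smul, smul_comm]

theorem dl_d0 (k : ℤ) (v : L) : V.dl k ⁅V.d 0, v⁆ = (k : ℂ) * V.dl k v := by
  induction v using V.ind with
  | h1 => simp [V.central_K₁]
  | h2 => simp [V.central_K₂]
  | hd m =>
    rw [V.bracket_dd]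
    by_cases h : m = k <;> split_ifs <;> simp_all
  | hE m x => rw [V.bracket_dE]; simp
  | hadd u v hu hv => simp [hu, hv, mul_add]
  | hsmul c v hv => simp [hv, mul_left_comm]

theorem e_lie_E (k n : ℤ) (x : g) (v : L) : V.e k ⁅v, V.E n x⁆ =
    ⁅V.e (k - n) v, x⁆ + ((n : ℂ) * V.dl (k - n) v) • x := by
  induction v using V.ind with
  | h1 => simp [V.K₁_lie]
  | h2 => simp [V.K₂_lie]
  | hd m =>
    rw [V.bracket_dE]
    have : m + n = k ↔ m = k - n := by omega
    by_cases h : m = k - n <;> simp [this, h]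
  | hE m y =>
    rw [V.bracket_EE]
    have : m + n = k ↔ m = k - n := by omega
    by_cases h : m = k - n <;> split_ifs <;> simp [this, h]
  | hadd u v hu hv => simp only [add_lie, map_add, hu, hv, mul_add, add_smul]; abel
  | hsmul c v hv =>
    simp only [smul_lie, map_smul, hv, smul_add, smul_smul, smul_eq_mul]
    rw [mul_left_comm]

theorem dl_lie_E (k n : ℤ) (x : g) (v : L) : V.dl k ⁅v, V.E n x⁆ = 0 := by
  induction v using V.ind with
  | h1 => simp [V.K₁_lie]
  | h2 => simp [V.K₂_lie]
  | hd m => rw [V.bracket_dE]; simp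
  | hE m y => rw [V.bracket_EE]; split_ifs <;> simp
  | hadd u v hu hv => simp [hu, hv]
  | hsmul c v hv => simp [hv]

theorem exists_prim (v : L) : ∃ w : L, ∀ n : ℤ, n ≠ 0 →
    (n : ℂ) • V.e n w = V.e n v ∧ (n : ℂ) * V.dl n w = V.dl n v := by
  induction v using V.ind with
  | h1 => exact ⟨0, by simp⟩
  | h2 => exact ⟨0, by simp⟩
  | hd m =>
    refine ⟨(m : ℂ)⁻¹ • V.d m, fun n hn => ⟨by simp, ?_⟩⟩
    by_cases h : m = n
    · subst h
      have : (m : ℂ) ≠ 0 := by exact_mod_cast hn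
      simp [this]
    · simp [h]
  | hE m x =>
    refine ⟨(m : ℂ)⁻¹ • V.E m x, fun n hn => ⟨?_, by simp⟩⟩
    by_cases h : m = n
    · subst h
      have : (m : ℂ) ≠ 0 := by exact_mod_cast hn
      simp [smul_smul, this]
    · simp [h]
  | hadd u v hu hv =>
    obtain ⟨a, ha⟩ := hu
    obtain ⟨b, hb⟩ := hv
    refine ⟨a + b, fun n hn => ?_⟩
    simp [← (ha n hn).1, ← (ha n hn).2, ← (hb n hn).1, ← (hb n hn).2, mul_add]
  | hsmul c v hv =>
    obtain ⟨a, ha⟩ := hv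
    refine ⟨c • a, fun n hn => ?_⟩
    rw [map_smul, map_smul, map_smul, map_smul, ← (ha n hn).1, ← (ha n hn).2]
    exact ⟨smul_comm _ _ _, mul_left_comm _ _ _⟩

variable [LieAlgebra.IsSimple ℂ g]

theorem coords_zero (v : L) (h : ∀ n x, ⁅v, V.E n x⁆ = 0) :
    (∀ n, V.e n v = 0) ∧ (∀ n, V.dl n v = 0) := by
  have he : ∀ n, V.e n v = 0 := by
    intro n
    apply av_center_zero
    intro y
    have := V.e_lie_E n 0 y v
    simpa [h] using this.symm
  refine ⟨he, fun n => ?_⟩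
  obtain ⟨a, b, hab⟩ := av_exists_lie (g := g)
  have := V.e_lie_E (n + 1) 1 ⁅a, b⁆ v
  simpa [h, he, hab] using this.symm

theorem dl_D (D : LieDerivation ℂ L L) (k n : ℤ) (x : g) : V.dl k (D (V.E n x)) = 0 := by
  refine av_perfect ((V.dl k) ∘ₗ D.toLinearMap ∘ₗ V.E n) (fun x y => ?_) x
  have h := V.bracket_EE 0 n x y
  have h' : V.E n ⁅x, y⁆ = ⁅V.E 0 x, V.E n y⁆ := by rw [h]; simp
  change V.dl k (D (V.E n ⁅x, y⁆)) = 0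
  rw [h', LieDerivation.apply_lie_eq_add, ← lie_skew (V.E 0 x), map_add, map_neg, V.dl_lie_E,
    V.dl_lie_E]
  simp

theorem D_K₁ (D : LieDerivation ℂ L L) (k : ℤ) : V.e k (D V.K₁) = 0 := by
  refine (V.coords_zero (D V.K₁) (fun n x => ?_)).1 k
  have := D.apply_lie_eq_add V.K₁ (V.E n x)
  simpa [V.K₁_lie] using this.symm

theorem e_D (D : LieDerivation ℂ L L) (k m n : ℤ) (x y : g) :
    V.e k (D (V.E (m + n) ⁅x, y⁆)) =
      ⁅x, V.e (k - m) (D (V.E n y))⁆ - ⁅y, V.e (k - n) (D (V.E m x))⁆ := by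
  have h := congrArg (fun v => V.e k (D v)) (V.bracket_EE m n x y)
  have h2 : V.e k (D (if m + n = 0 then ((m : ℂ) * killingForm ℂ g x y) • V.K₁ else 0)) = 0 := by
    split_ifs <;> simp [V.D_K₁]
  simp only [map_add, h2, add_zero] at h
  rw [← h, LieDerivation.apply_lie_eq_add, ← lie_skew (V.E m x), map_add, map_neg,
    V.e_lie_E, V.e_lie_E, V.dl_D, V.dl_D, ← lie_skew x, ← lie_skew y]
  simp only [mul_zero, zero_smul, add_zero]
  abel

theorem D_zero [FiniteDimensional ℂ g] (D : LieDerivation ℂ L L)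
    (h : ∀ k n x, V.e k (D (V.E n x)) = 0) (v : L) : D v = 0 := by
  have hc : ∀ n x (w : L), ⁅D (V.E n x), w⁆ = 0 := fun n x w =>
    V.central_of _ (fun k => h k n x) (fun k => V.dl_D D k n x) w
  have hE : ∀ n x, D (V.E n x) = 0 := by
    intro n x
    refine av_perfect (D.toLinearMap ∘ₗ V.E n) (fun x y => ?_) x
    have h' : V.E n ⁅x, y⁆ = ⁅V.E 0 x, V.E n y⁆ := by rw [V.bracket_EE 0 n x y]; simp
    change D (V.E n ⁅x, y⁆) = 0
    rw [h', LieDerivation.apply_lie_eq_add, hc, ← lie_skew, hc]; simp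
  have hdc : ∀ m (w : L), ⁅D (V.d m), w⁆ = 0 := by
    intro m w
    obtain ⟨h1, h2⟩ := V.coords_zero (D (V.d m)) (fun n x => by
      have := D.apply_lie_eq_add (V.d m) (V.E n x)
      simpa [V.bracket_dE, hE] using this.symm)
    exact V.central_of _ h1 h2 w
  have hdd : ∀ m n, D ⁅V.d m, V.d n⁆ = 0 := by
    intro m n
    rw [LieDerivation.apply_lie_eq_add, hdc, ← lie_skew, hdc]; simp
  have hd0 : D (V.d 0) = 0 := by
    have := hdd 1 (-1)
    rw [V.bracket_dd] at this
    norm_num at this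
    exact this
  have hd : ∀ m, D (V.d m) = 0 := by
    intro m
    by_cases hm : m = 0
    · subst hm; exact hd0
    have := hdd 0 m
    rw [V.bracket_dd] at this
    simpa [hm] using this
  induction v using V.ind with
  | h1 =>
    obtain ⟨x, y, hxy⟩ := av_killing (g := g)
    have := congrArg D (V.bracket_EE 1 (-1) x y)
    rw [LieDerivation.apply_lie_eq_add] at this
    simpa [hE, hxy] using this.symm
  | h2 =>
    have := hdd 2 (-2)
    rw [V.bracket_dd] at this
    norm_num [hd0] at this
    exact this
  | hd m => exact hd m
  | hE m x => exact hE m x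
  | hadd u v hu hv => simp [hu, hv]
  | hsmul c v hv => simp [hv]

theorem homog (D : LieDerivation ℂ L L) (h : ∀ n : ℤ, n ≠ 0 →
    V.e n (D (V.d 0)) = 0 ∧ V.dl n (D (V.d 0)) = 0) (k n : ℤ) (hk : k ≠ n) (x : g) :
    V.e k (D (V.E n x)) = 0 := by
  have h1 := congrArg (fun v => V.e k (D v)) (V.bracket_dE 0 n x)
  have hs : k - n ≠ 0 := sub_ne_zero.2 hk
  simp only [LieDerivation.apply_lie_eq_add, map_add, V.e_d0, V.e_lie_E, (h _ hs).1, (h _ hs).2,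
    zero_lie, mul_zero, zero_smul, add_zero, zero_add, map_smul] at h1
  rw [← sub_eq_zero, ← sub_smul, smul_eq_zero] at h1
  rcases h1 with h1 | h1
  · exfalso
    apply hk
    exact_mod_cast sub_eq_zero.1 h1
  · exact h1

theorem all_inner [FiniteDimensional ℂ g] (V : AffineVirasoro g L) (D : LieDerivation ℂ L L) :
    ∃ u : L, ∀ x : L, D x = ⁅u, x⁆ := by
  obtain ⟨w, hw⟩ := V.exists_prim (D (V.d 0))
  let D₁ : LieDerivation ℂ L L := D + LieDerivation.ad ℂ L w
  have hD₁ : ∀ v, D₁ v = D v + ⁅w, v⁆ := fun v => by simp [D₁]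
  have hom := V.homog D₁ (fun n hn => by
    rw [hD₁, ← lie_skew, map_add, map_add, map_neg, map_neg, V.e_d0, V.dl_d0, (hw n hn).1,
      (hw n hn).2]
    simp)
  let φ : ℤ → g →ₗ[ℂ] g := fun n => V.e n ∘ₗ D₁.toLinearMap ∘ₗ V.E n
  have hφ : ∀ n x, φ n x = V.e n (D₁ (V.E n x)) := fun _ _ => rfl
  have hφl : ∀ m n x y, φ (m + n) ⁅x, y⁆ = ⁅x, φ n y⁆ - ⁅y, φ m x⁆ := by
    intro m n x y
    rw [hφ, hφ, hφ, V.e_D]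
    simp
  obtain ⟨a, ha⟩ := av_inner (φ 0) (fun x y => by simpa using hφl 0 0 x y)
  have hsch : ∀ n, ∃ c : ℂ, ∀ x, φ n x = ⁅a, x⁆ + c • x := by
    intro n
    obtain ⟨c, hc⟩ := av_schur (φ n - (LieAlgebra.ad ℂ g a)) (fun x y => by
      have := hφl 0 n x y
      rw [zero_add] at this
      simp only [LinearMap.sub_apply, LieAlgebra.ad_apply, this, ha, lie_sub]
      rw [leibniz_lie a x y, ← lie_skew y ⁅a, x⁆]
      abel)
    refine ⟨c, fun x => ?_⟩
    rw [← hc]; simp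
  choose c hc using hsch
  have hcadd : ∀ m n, c (m + n) = c m + c n := by
    intro m n
    obtain ⟨x, y, hxy⟩ := av_exists_lie (g := g)
    have := hφl m n x y
    rw [hc, hc, hc, leibniz_lie a x y, lie_add, lie_add, lie_smul, lie_smul,
      ← lie_skew y ⁅a, x⁆, ← lie_skew y x] at this
    have h2 : (c (m + n) - (c m + c n)) • ⁅x, y⁆ = 0 := by
      rw [← sub_eq_zero.2 this]
      module
    rcases smul_eq_zero.1 h2 with h3 | h3
    · exact sub_eq_zero.1 h3
    · exact absurd h3 hxy
  have hcn : ∀ n : ℤ, c n = n * c 1 := by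
    intro n
    have := map_zsmul (AddMonoidHom.mk' c hcadd) n 1
    simpa using this
  let D₂ : LieDerivation ℂ L L := D₁ - LieDerivation.ad ℂ L (V.E 0 a + c 1 • V.d 0)
  have hD₂ : ∀ v, D₂ v = D₁ v - ⁅V.E 0 a + c 1 • V.d 0, v⁆ := fun v => by simp [D₂]
  have hz := V.D_zero D₂ (fun k n x => by
    rw [hD₂, map_sub, V.e_lie_E]
    by_cases hk : k = n
    · subst hk
      rw [← hφ, hc, hcn]
      simp
    · have hk' : (0 : ℤ) ≠ k - n := (sub_ne_zero.2 hk).symm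
      rw [hom k n hk x]
      simp [hk'])
  refine ⟨V.E 0 a + c 1 • V.d 0 - w, fun v => ?_⟩
  have := hz v
  rw [hD₂, hD₁] at this
  rw [sub_lie, ← sub_eq_zero, ← this]
  abel

end AffineVirasoro

/-- Every derivation of the affine-Virasoro Lie algebra is inner. -/
theorem affineVirasoro_derivations_inner (g L : Type*) [LieRing g] [LieAlgebra ℂ g] [LieAlgebra.IsSimple ℂ g] [FiniteDimensional ℂ g] [LieRing L] [LieAlgebra ℂ L] (V : AffineVirasoro g L)
    (D : LieDerivation ℂ L L) :
    ∃ u : L, ∀ x : L, D x = ⁅u, x⁆ := by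
  exact V.all_inner D
end

section
/- Let $\mathfrak{g}$ be a finite-dimensional complex simple Lie algebra. Every skew-symmetric biderivation $F$ of $\mathfrak{L}(\mathfrak{g})/Z(\mathfrak{L}(\mathfrak{g}))$ is inner: there exists $\lambda \in \mathbb{C}$ such that $F(x,y) = \lambda[x,y]$ for all $x,y$. -/
theorem bider_identity {M : Type*} [LieRing M] [LieAlgebra ℂ M] (F : M →ₗ[ℂ] M →ₗ[ℂ] M)
    (hskew : ∀ x y, F x y = - F y x)
    (h1 : ∀ x y z, F ⁅x, y⁆ z = ⁅x, F y z⁆ - ⁅y, F x z⁆)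
    (h2 : ∀ x y z, F x ⁅y, z⁆ = ⁅y, F x z⁆ - ⁅z, F x y⁆) (x y u v : M) :
    ⁅F x y, ⁅u, v⁆⁆ = ⁅⁅x, y⁆, F u v⁆ := by
  let A : M → M → M → M → M := fun x y u v => ⁅⁅x, y⁆, F u v⁆ + ⁅⁅u, v⁆, F x y⁆
  have hA : ∀ x y u v, A x y u v = A x v u y := by
    intro x y u v
    have e1 : F ⁅x, u⁆ ⁅y, v⁆ = _ := h1 x u ⁅y, v⁆
    have e2 : F ⁅x, u⁆ ⁅y, v⁆ = _ := h2 ⁅x, u⁆ y v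
    rw [e1] at e2
    simp only [h1, h2, lie_sub] at e2
    simp only [A, lie_lie]
    rw [← sub_eq_zero] at e2 ⊢
    rw [← e2]
    abel
  have hB : ∀ x y u v, A x y u v = - A y x u v := by
    intro x y u v
    simp only [A]
    rw [hskew y x, ← lie_skew x y]
    simp only [lie_neg, neg_lie, neg_add, neg_neg]
  have h : A x y u v = - A x y u v := by
    calc A x y u v = A x v u y := hA _ _ _ _
      _ = - A v x u y := hB _ _ _ _
      _ = - A v y u x := by rw [hA]
      _ = A y v u x := by rw [hB v y, neg_neg]
      _ = A y x u v := hA _ _ _ _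
      _ = - A x y u v := hB _ _ _ _
  have h0 : A x y u v = 0 := by
    have : (2:ℂ) • A x y u v = 0 := by
      rw [two_smul]; nth_rewrite 1 [h]; simp
    simpa using this
  simp only [A] at h0
  rw [← lie_skew (F x y) (⁅u, v⁆), eq_comm, ← add_eq_zero_iff_eq_neg]
  exact h0

theorem bider_core {g M : Type*} [LieRing g] [LieAlgebra ℂ g] [LieRing M] [LieAlgebra ℂ M]
    (hg : ∀ x : g, (∀ y : g, ⁅y, x⁆ = 0) → x = 0)
    (e : ℤ → g → M) (δ : ℤ → M) (Pe : ℤ → M →ₗ[ℂ] g) (Pd : ℤ → M →ₗ[ℂ] ℂ)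
    (hde : ∀ n x, ⁅δ 0, e n x⁆ = (n : ℂ) • e n x)
    (hdd : ∀ m n, ⁅δ m, δ n⁆ = ((n : ℂ) - m) • δ (m + n))
    (Pe_d : ∀ k n, Pe k (δ n) = 0) (Pd_d : ∀ k n, Pd k (δ n) = if k = n then 1 else 0)
    (Pe_e : ∀ k n x, k ≠ n → Pe k (e n x) = 0)
    (Pel : ∀ k n w, Pe (n + k) ⁅δ n, w⁆ = (k : ℂ) • Pe k w)
    (Pdl : ∀ k n w, Pd (n + k) ⁅δ n, w⁆ = ((k : ℂ) - n) * Pd k w)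
    (Pee : ∀ k n y w, Pe (n + k) ⁅e n y, w⁆ = ⁅y, Pe k w⁆ - ((n : ℂ) * Pd k w) • y)
    (hext : ∀ w, (∀ k, Pe k w = 0) → (∀ k, Pd k w = 0) → w = 0)
    (F : M →ₗ[ℂ] M →ₗ[ℂ] M)
    (hskew : ∀ x y, F x y = - F y x)
    (h1 : ∀ x y z, F ⁅x, y⁆ z = ⁅x, F y z⁆ - ⁅y, F x z⁆)
    (h2 : ∀ x y z, F x ⁅y, z⁆ = ⁅y, F x z⁆ - ⁅z, F x y⁆) :
    ∃ lam : ℂ, ∀ x y, F x y = lam • ⁅x, y⁆ := by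
  have B := bider_identity F hskew h1 h2
  have hself : ∀ x, F x x = 0 := fun x => by
    have h : (2:ℂ) • F x x = 0 := by
      rw [two_smul]; nth_rewrite 1 [hskew]; simp
    simpa using h
  have hD : ∀ z, F (δ 0) ⁅δ 0, z⁆ = ⁅δ 0, F (δ 0) z⁆ := by
    intro z; rw [h2, hself, lie_zero, sub_zero]
  have hd0 : ∀ n, ⁅δ 0, δ n⁆ = (n : ℂ) • δ n := by
    intro n; rw [hdd]; simp
  -- components of D z for z of degree n
  have degE : ∀ (n k : ℤ) z, ⁅δ 0, z⁆ = (n : ℂ) • z → k ≠ n → Pe k (F (δ 0) z) = 0 := by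
    intro n k z hz hk
    have h := congrArg (Pe (0 + k)) (hD z)
    rw [Pel, hz] at h
    simp only [map_smul, zero_add] at h
    rw [← sub_eq_zero, ← sub_smul, smul_eq_zero] at h
    rcases h with h | h
    · exact absurd (by exact_mod_cast (sub_eq_zero.1 h).symm) hk
    · exact h
  have degD : ∀ (n k : ℤ) z, ⁅δ 0, z⁆ = (n : ℂ) • z → k ≠ n → Pd k (F (δ 0) z) = 0 := by
    intro n k z hz hk
    have h := congrArg (Pd (0 + k)) (hD z)
    rw [Pdl, hz] at h
    simp only [map_smul, zero_add, smul_eq_mul, Int.cast_zero, sub_zero] at h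
    rw [← sub_eq_zero, ← sub_mul, mul_eq_zero] at h
    rcases h with h | h
    · exact absurd (by exact_mod_cast (sub_eq_zero.1 h).symm) hk
    · exact h
  have hDd : ∀ n : ℤ, n ≠ 0 → F (δ 0) (δ n) = (Pd n (F (δ 0) (δ n))) • δ n := by
    intro n hn
    have hn' : (n : ℂ) ≠ 0 := by exact_mod_cast hn
    have hc : ⁅δ n, F (δ 0) (δ n)⁆ = 0 := by
      have h := B (δ 0) (δ n) (δ 0) (δ n)
      rw [hd0, lie_smul, smul_lie, ← lie_skew, smul_right_inj hn'] at h
      have h' : (2:ℂ) • ⁅δ n, F (δ 0) (δ n)⁆ = 0 := by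
        rw [two_smul]; nth_rewrite 1 [← h]; exact neg_add_cancel _
      simpa using h'
    rw [← sub_eq_zero]
    apply hext
    · intro k
      rw [map_sub, map_smul, Pe_d, smul_zero, sub_zero]
      by_cases hk : k = n
      · subst hk
        have h := congrArg (Pe (k + k)) hc
        rw [Pel, map_zero, smul_eq_zero] at h
        exact h.resolve_left hn'
      · exact degE n k _ (hd0 n) hk
    · intro k
      rw [map_sub, map_smul, Pd_d]
      by_cases hk : k = n
      · subst hk; simp
      · rw [degD n k _ (hd0 n) hk]; simp [hk]
  obtain ⟨lam, hlam⟩ : ∃ lam : ℂ, lam = Pd 1 (F (δ 0) (δ 1)) := ⟨_, rfl⟩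
  have hDn : ∀ n : ℤ, n ≠ 0 → F (δ 0) (δ n) = (n * lam : ℂ) • δ n := by
    intro n hn
    by_cases hn1 : n = 1
    · subst hn1
      rw [hDd 1 one_ne_zero, ← hlam]; simp
    · have h := B (δ 0) (δ n) (δ 0) (δ 1)
      rw [hDd n hn, hDd 1 one_ne_zero, ← hlam, hd0, hd0] at h
      simp only [smul_lie, lie_smul, hdd] at h
      have h' := congrArg (Pd (n + 1)) h
      simp only [map_smul, Pd_d, smul_eq_mul, if_true] at h'
      have h3 : ((1:ℤ) : ℂ) - n ≠ 0 := by
        rw [sub_ne_zero]; exact_mod_cast (Ne.symm hn1)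
      have h4 : Pd n (F (δ 0) (δ n)) = n * lam := by
        apply mul_right_cancel₀ h3
        push_cast at h' ⊢
        linear_combination h'
      rw [hDd n hn, h4]
  refine ⟨lam, fun u v => ?_⟩
  have key : ∀ u v, ∀ n : ℤ, n ≠ 0 → ⁅δ n, F u v - lam • ⁅u, v⁆⁆ = 0 := by
    intro u v n hn
    have hn' : (n : ℂ) ≠ 0 := by exact_mod_cast hn
    have h := B (δ 0) (δ n) u v
    rw [hDn n hn, hd0, smul_lie, smul_lie, mul_smul, smul_right_inj hn'] at h
    rw [lie_sub, lie_smul, h, sub_self]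
  have GPd : ∀ u v k, Pd k (F u v - lam • ⁅u, v⁆) = 0 := by
    intro u v k
    obtain ⟨n, hn, hkn⟩ : ∃ n : ℤ, n ≠ 0 ∧ k ≠ n := by
      by_cases h : k = 1
      · exact ⟨2, by norm_num, by omega⟩
      · exact ⟨1, by norm_num, h⟩
    have h := congrArg (Pd (n + k)) (key u v n hn)
    rw [Pdl, map_zero, mul_eq_zero] at h
    refine h.resolve_left ?_
    intro h'
    exact hkn (by exact_mod_cast sub_eq_zero.1 h')
  have GPe : ∀ u v k, k ≠ 0 → Pe k (F u v - lam • ⁅u, v⁆) = 0 := by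
    intro u v k hk
    have h := congrArg (Pe (1 + k)) (key u v 1 one_ne_zero)
    rw [Pel, map_zero, smul_eq_zero] at h
    exact h.resolve_left (by exact_mod_cast hk)
  have hDe : ∀ y, F (δ 0) (e 1 y) = lam • e 1 y := by
    intro y
    have hy : ⁅δ 0, e 1 y⁆ = ((1:ℤ) : ℂ) • e 1 y := hde 1 y
    have hy' : ⁅δ 0, e 1 y⁆ = e 1 y := by rw [hy]; simp
    rw [← sub_eq_zero]
    apply hext
    · intro k
      by_cases hk : k = 0
      · subst hk
        rw [map_sub, degE 1 0 _ hy (by norm_num), map_smul, Pe_e 0 1 y (by norm_num)]; simp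
      · have := GPe (δ 0) (e 1 y) k hk
        rwa [hy'] at this
    · intro k
      have := GPd (δ 0) (e 1 y) k
      rwa [hy'] at this
  rw [← sub_eq_zero]
  refine hext _ (fun k => ?_) (GPd u v)
  by_cases hk : k = 0
  · subst hk
    apply hg
    intro y
    have hy' : ⁅δ 0, e 1 y⁆ = e 1 y := by rw [hde]; simp
    have h := B (δ 0) (e 1 y) u v
    rw [hDe, hy', smul_lie, ← lie_smul, eq_comm, ← sub_eq_zero, ← lie_sub] at h
    have h' := congrArg (Pe (1 + 0)) h
    rw [Pee, GPd, map_zero] at h'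
    simpa using h'
  · exact GPe u v k hk

noncomputable def AffineVirasoro.Phi {g L : Type*} [LieRing g] [LieAlgebra ℂ g]
    [LieRing L] [LieAlgebra ℂ L] (V : AffineVirasoro g L) :
    ((ℤ →₀ g) × (ℤ →₀ ℂ) × ℂ × ℂ) →ₗ[ℂ] L :=
  LinearMap.coprod (Finsupp.lsum ℂ V.E)
    (LinearMap.coprod (Finsupp.lsum ℂ (fun m => LinearMap.toSpanSingleton ℂ L (V.d m)))
      (LinearMap.coprod (LinearMap.toSpanSingleton ℂ L V.K₁)
        (LinearMap.toSpanSingleton ℂ L V.K₂)))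

theorem AffineVirasoro.Phi_bij {g L : Type*} [LieRing g] [LieAlgebra ℂ g]
    [LieRing L] [LieAlgebra ℂ L] (V : AffineVirasoro g L) : Function.Bijective V.Phi := by
  constructor
  · rw [← LinearMap.ker_eq_bot, LinearMap.ker_eq_bot']
    rintro ⟨f, c, a, b⟩ h
    have := V.indep f c a b (by
      rw [← h]
      simp [AffineVirasoro.Phi, Finsupp.lsum_apply, add_assoc]
      rfl)
    obtain ⟨rfl, rfl, rfl, rfl⟩ := this
    rfl
  · rw [← LinearMap.range_eq_top, eq_top_iff, ← V.spans, Submodule.span_le]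
    rintro w (((rfl | rfl) | ⟨m, rfl⟩) | hw)
    · exact ⟨(0, 0, 1, 0), by simp [AffineVirasoro.Phi]⟩
    · exact ⟨(0, 0, 0, 1), by simp [AffineVirasoro.Phi]⟩
    · exact ⟨(0, Finsupp.single m 1, 0, 0), by simp [AffineVirasoro.Phi]⟩
    · rw [Set.mem_iUnion] at hw
      obtain ⟨m, x, rfl⟩ := hw
      exact ⟨(Finsupp.single m x, 0, 0, 0), by simp [AffineVirasoro.Phi]⟩

theorem AffineVirasoro.exists_coords {g L : Type*} [LieRing g] [LieAlgebra ℂ g]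
    [LieRing L] [LieAlgebra ℂ L] (V : AffineVirasoro g L) :
    ∃ (Pe : ℤ → L →ₗ[ℂ] g) (Pd : ℤ → L →ₗ[ℂ] ℂ),
      (∀ k n x, Pe k (V.E n x) = if k = n then x else 0) ∧ (∀ k n, Pe k (V.d n) = 0) ∧
      (∀ k, Pe k V.K₁ = 0) ∧ (∀ k, Pe k V.K₂ = 0) ∧
      (∀ k n x, Pd k (V.E n x) = 0) ∧ (∀ k n, Pd k (V.d n) = if k = n then 1 else 0) ∧
      (∀ k, Pd k V.K₁ = 0) ∧ (∀ k, Pd k V.K₂ = 0) ∧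
      (∀ w, (∀ k, Pe k w = 0) → (∀ k, Pd k w = 0) → ∃ a b : ℂ, w = a • V.K₁ + b • V.K₂) := by
  let Ψ := LinearEquiv.ofBijective V.Phi V.Phi_bij
  have hE : ∀ n x, Ψ.symm (V.E n x) = (Finsupp.single n x, 0, 0, 0) := fun n x => by
    rw [LinearEquiv.symm_apply_eq]; simp [Ψ, AffineVirasoro.Phi]
  have hd : ∀ n, Ψ.symm (V.d n) = (0, Finsupp.single n 1, 0, 0) := fun n => by
    rw [LinearEquiv.symm_apply_eq]; simp [Ψ, AffineVirasoro.Phi]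
  have hK1 : Ψ.symm V.K₁ = (0, 0, 1, 0) := by
    rw [LinearEquiv.symm_apply_eq]; simp [Ψ, AffineVirasoro.Phi]
  have hK2 : Ψ.symm V.K₂ = (0, 0, 0, 1) := by
    rw [LinearEquiv.symm_apply_eq]; simp [Ψ, AffineVirasoro.Phi]
  refine ⟨fun k => (Finsupp.lapply k) ∘ₗ (LinearMap.fst ℂ _ _) ∘ₗ Ψ.symm.toLinearMap,
    fun k => (Finsupp.lapply k) ∘ₗ (LinearMap.fst ℂ _ _) ∘ₗ (LinearMap.snd ℂ _ _) ∘ₗ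
      Ψ.symm.toLinearMap, ?_, ?_, ?_, ?_, ?_, ?_, ?_, ?_, ?_⟩
  · intro k n x; simp [hE, Finsupp.single_apply, eq_comm]
  · intro k n; simp [hd]
  · intro k; simp [hK1]
  · intro k; simp [hK2]
  · intro k n x; simp [hE]
  · intro k n; simp [hd, Finsupp.single_apply, eq_comm]
  · intro k; simp [hK1]
  · intro k; simp [hK2]
  · intro w h1 h2
    obtain ⟨⟨f, c, a, b⟩, rfl⟩ := Ψ.surjective w
    have hf : f = 0 := by ext k; simpa using h1 k
    have hc : c = 0 := by ext k; simpa using h2 k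
    subst hf hc
    exact ⟨a, b, by simp [Ψ, AffineVirasoro.Phi]⟩

theorem AffineVirasoro.ind_s13 {g L : Type*} [LieRing g] [LieAlgebra ℂ g]
    [LieRing L] [LieAlgebra ℂ L] (V : AffineVirasoro g L) {N : Type*} [AddCommGroup N]
    [Module ℂ N] (S T : L →ₗ[ℂ] N) (hE : ∀ n x, S (V.E n x) = T (V.E n x))
    (hd : ∀ n, S (V.d n) = T (V.d n)) (h1 : S V.K₁ = T V.K₁) (h2 : S V.K₂ = T V.K₂) (w : L) :
    S w = T w := by
  have : S = T := by
    apply LinearMap.ext_on V.spans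
    rintro w (((rfl | rfl) | ⟨m, rfl⟩) | hw)
    · exact h1
    · exact h2
    · exact hd m
    · rw [Set.mem_iUnion] at hw
      obtain ⟨m, x, rfl⟩ := hw
      exact hE m x
  rw [this]

/-- Every skew-symmetric biderivation of L(g)/Z(L(g)) is inner. -/
theorem affineVirasoro_quotient_skew_biderivation_inner (g L : Type*) [LieRing g] [LieAlgebra ℂ g] [LieAlgebra.IsSimple ℂ g] [FiniteDimensional ℂ g] [LieRing L] [LieAlgebra ℂ L] (V : AffineVirasoro g L)
    (F : (L ⧸ LieAlgebra.center ℂ L) →ₗ[ℂ]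
        (L ⧸ LieAlgebra.center ℂ L) →ₗ[ℂ] (L ⧸ LieAlgebra.center ℂ L))
    (hskew : ∀ x y, F x y = - F y x)
    (h1 : ∀ x y z, F ⁅x, y⁆ z = ⁅x, F y z⁆ - ⁅y, F x z⁆)
    (h2 : ∀ x y z, F x ⁅y, z⁆ = ⁅y, F x z⁆ - ⁅z, F x y⁆) :
    ∃ lam : ℂ, ∀ x y, F x y = lam • ⁅x, y⁆ := by
  classical
  obtain ⟨Pe, Pd, PeE, PeD, PeK1, PeK2, PdE, PdD, PdK1, PdK2, hext⟩ := V.exists_coords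
  have hg : ∀ x : g, (∀ y : g, ⁅y, x⁆ = 0) → x = 0 := by
    intro x hx
    have : x ∈ LieAlgebra.center ℂ g := by
      rw [LieModule.mem_maxTrivSubmodule]; exact hx
    rwa [LieAlgebra.center_eq_bot, LieSubmodule.mem_bot] at this
  have Pel : ∀ (k n : ℤ) w, Pe (n + k) ⁅V.d n, w⁆ = (k : ℂ) • Pe k w := by
    intro k n w
    refine V.ind_s13 ((Pe (n + k)) ∘ₗ (LieAlgebra.ad ℂ L (V.d n) : L →ₗ[ℂ] L)) ((k : ℂ) • Pe k)
      ?_ ?_ ?_ ?_ w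
    · intro m x
      by_cases h : k = m
      · subst h; simp [V.bracket_dE, PeE]
      · simp [V.bracket_dE, PeE, h]
    · intro m
      simp only [LinearMap.comp_apply, LieAlgebra.ad_apply, V.bracket_dd, map_add, map_smul, PeD]
      split_ifs <;> simp [PeK2, PeD]
    · simp [V.central_K₁, PeK1]
    · simp [V.central_K₂, PeK2]
  have Pdl : ∀ (k n : ℤ) w, Pd (n + k) ⁅V.d n, w⁆ = ((k : ℂ) - n) * Pd k w := by
    intro k n w
    refine V.ind_s13 ((Pd (n + k)) ∘ₗ (LieAlgebra.ad ℂ L (V.d n) : L →ₗ[ℂ] L))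
      (((k : ℂ) - n) • Pd k) ?_ ?_ ?_ ?_ w
    · intro m x
      simp [V.bracket_dE, PdE]
    · intro m
      simp only [LinearMap.comp_apply, LieAlgebra.ad_apply, V.bracket_dd, map_add, map_smul, PdD,
        LinearMap.smul_apply]
      have : Pd (n + k) (if n + m = 0 then (((n : ℂ) ^ 3 - (n : ℂ)) / 12) • V.K₂ else 0) = 0 := by
        split_ifs <;> simp [PdK2]
      rw [this]
      by_cases h : k = m
      · subst h; simp
      · simp [h]
    · simp [V.central_K₁, PdK1]
    · simp [V.central_K₂, PdK2]
  have Pee : ∀ (k n : ℤ) y w,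
      Pe (n + k) ⁅V.E n y, w⁆ = ⁅y, Pe k w⁆ - ((n : ℂ) * Pd k w) • y := by
    intro k n y w
    have := V.ind_s13 ((Pe (n + k)) ∘ₗ (LieAlgebra.ad ℂ L (V.E n y) : L →ₗ[ℂ] L))
      ((LieAlgebra.ad ℂ g y : g →ₗ[ℂ] g) ∘ₗ Pe k
        - (LinearMap.toSpanSingleton ℂ g y) ∘ₗ ((n : ℂ) • Pd k)) ?_ ?_ ?_ ?_ w
    · simpa using this
    · intro m x
      simp only [LinearMap.comp_apply, LieAlgebra.ad_apply, V.bracket_EE, map_add, PeE,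
        LinearMap.sub_apply, LinearMap.smul_apply, PdE]
      have : Pe (n + k) (if n + m = 0 then ((n : ℂ) * killingForm ℂ g y x) • V.K₁ else 0) = 0 := by
        split_ifs <;> simp [PeK1]
      rw [this]
      by_cases h : k = m
      · subst h; simp
      · simp [h]
    · intro m
      simp only [LinearMap.comp_apply, LieAlgebra.ad_apply]
      rw [← lie_skew, V.bracket_dE]
      by_cases h : k = m
      · subst h; simp [PeE, PeD, PdD, add_comm]
      · have : ¬ (n + k = m + n) := by omega
        simp [PeE, PeD, PdD, h, this]
    · simp [V.central_K₁, PeK1, PdK1]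
    · simp [V.central_K₂, PeK2, PdK2]
  have cPd : ∀ k, ∀ w ∈ LieAlgebra.center ℂ L, Pd k w = 0 := by
    intro k w hw
    rw [LieModule.mem_maxTrivSubmodule] at hw
    have h := Pdl k (k + 1) w
    rw [hw, map_zero] at h
    push_cast at h
    linear_combination h
  have cPe : ∀ k, ∀ w ∈ LieAlgebra.center ℂ L, Pe k w = 0 := by
    intro k w hw
    have hw' := hw
    rw [LieModule.mem_maxTrivSubmodule] at hw
    apply hg
    intro y
    have h := Pee k 0 y w
    rw [hw, map_zero] at h
    simpa using h.symm
  let Z := (LieAlgebra.center ℂ L)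
  let π : L → L ⧸ LieAlgebra.center ℂ L := fun x => LieSubmodule.Quotient.mk x
  have πs : Function.Surjective π := fun w => Submodule.Quotient.mk_surjective _ w
  have πlie : ∀ x y, π ⁅x, y⁆ = ⁅π x, π y⁆ := fun x y => LieSubmodule.Quotient.mk_bracket _ x y
  have πsmul : ∀ (c : ℂ) x, π (c • x) = c • π x := fun c x => rfl
  have πz : ∀ x, x ∈ LieAlgebra.center ℂ L → π x = 0 := fun x hx =>
    (Submodule.Quotient.mk_eq_zero _).2 hx
  have hK1 : V.K₁ ∈ LieAlgebra.center ℂ L := by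
    rw [LieModule.mem_maxTrivSubmodule]; exact V.central_K₁
  have hK2 : V.K₂ ∈ LieAlgebra.center ℂ L := by
    rw [LieModule.mem_maxTrivSubmodule]; exact V.central_K₂
  refine bider_core hg (fun n x => π (V.E n x)) (fun n => π (V.d n))
    (fun k => Submodule.liftQ (LieAlgebra.center ℂ L).toSubmodule (Pe k) (cPe k))
    (fun k => Submodule.liftQ (LieAlgebra.center ℂ L).toSubmodule (Pd k) (cPd k))
    ?_ ?_ ?_ ?_ ?_ ?_ ?_ ?_ ?_ F hskew h1 h2
  · intro n x
    rw [← πlie, V.bracket_dE, zero_add, πsmul]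
  · intro m n
    rw [← πlie, V.bracket_dd, ← πsmul, ← sub_eq_zero]
    apply πz (_ - _)
    rw [add_sub_cancel_left]
    split_ifs
    · exact Submodule.smul_mem _ _ hK2
    · exact Submodule.zero_mem _
  · intro k n; exact PeD k n
  · intro k n; exact PdD k n
  · intro k n x h
    exact (PeE k n x).trans (if_neg h)
  · intro k n w
    obtain ⟨w, rfl⟩ := πs w
    rw [← πlie]; exact Pel k n w
  · intro k n w
    obtain ⟨w, rfl⟩ := πs w
    rw [← πlie]; exact Pdl k n w
  · intro k n y w
    obtain ⟨w, rfl⟩ := πs w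
    rw [← πlie]; exact Pee k n y w
  · intro w h h'
    obtain ⟨w, rfl⟩ := πs w
    obtain ⟨a, b, rfl⟩ := hext w h h'
    apply πz
    exact Submodule.add_mem _ (Submodule.smul_mem _ _ hK1) (Submodule.smul_mem _ _ hK2)
end

section
/- Let $\mathfrak{g}$ be a finite-dimensional complex simple Lie algebra. Every skew-symmetric biderivation of the affine-Virasoro Lie algebra $\mathfrak{L}(\mathfrak{g})$ is inner, i.e., of the form $F(x,y) = \lambda [x,y]$ for some $\lambda \in \mathbb{C}$. -/
namespace AffVirProof

variable {g L : Type*} [LieRing g] [LieAlgebra ℂ g] [LieRing L] [LieAlgebra ℂ L]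

theorem self_neg {x : L} (h : x = -x) : x = 0 := by
  have h2 : (2 : ℂ) • x = 0 := by
    rw [two_smul]; nth_rewrite 1 [h]; simp
  exact (smul_eq_zero.mp h2).resolve_left two_ne_zero

theorem key (F : L →ₗ[ℂ] L →ₗ[ℂ] L)
    (hskew : ∀ x y : L, F x y = - F y x)
    (h1 : ∀ x y z : L, F ⁅x, y⁆ z = ⁅x, F y z⁆ - ⁅y, F x z⁆)
    (h2 : ∀ x y z : L, F x ⁅y, z⁆ = ⁅y, F x z⁆ - ⁅z, F x y⁆) (x y u v : L) :
    ⁅F x y, ⁅u, v⁆⁆ = ⁅⁅x, y⁆, F u v⁆ := by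
  let H : L → L → L → L → L := fun x y u v => ⁅F x y, ⁅u, v⁆⁆ - ⁅⁅x, y⁆, F u v⁆
  have s12 : ∀ x y u v, H x y u v = - H y x u v := by
    intro x y u v
    simp only [H]
    rw [hskew x y, ← lie_skew x y, neg_lie, neg_lie]; abel
  have s34 : ∀ x y u v, H x y u v = - H x y v u := by
    intro x y u v
    simp only [H]
    rw [hskew u v, ← lie_skew u v, lie_neg, lie_neg]; abel
  have s24 : ∀ x y u v, H x y u v = H x v u y := by
    intro x y u v
    have e1 := h1 x u ⁅y, v⁆
    have e2 := h2 ⁅x, u⁆ y v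
    rw [h2 u, h2 x] at e1
    rw [e1, h1, h1] at e2
    simp only [H]
    rw [← lie_skew (F x y), ← lie_skew (F x v)]
    simp only [lie_sub, lie_lie] at e2 ⊢
    rw [← sub_eq_zero] at e2 ⊢
    rw [← neg_eq_zero, ← e2]
    abel
  have h0 : H x y u v = - H x y u v := by
    have a1 : H x y u v = H v y u x := by
      rw [s12, s24, s12, neg_neg]
    have a2 : H x y u v = - H v y u x := by
      rw [s24 x y u v, s12, s24 v x u y]
    rw [← a1] at a2
    exact a2
  have : H x y u v = 0 := self_neg h0
  exact sub_eq_zero.mp this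

theorem ext_gen (V : AffineVirasoro g L) {M : Type*} [AddCommGroup M] [Module ℂ M]
    (T : L →ₗ[ℂ] M) (hE : ∀ m x, T (V.E m x) = 0) (hd : ∀ m, T (V.d m) = 0)
    (hK1 : T V.K₁ = 0) (hK2 : T V.K₂ = 0) (w : L) : T w = 0 := by
  have : T = 0 := by
    apply LinearMap.ext_on V.spans
    rintro z ((hz | ⟨m, rfl⟩) | hz)
    · rcases hz with rfl | rfl
      · simpa using hK1
      · simpa using hK2
    · simpa using hd m
    · obtain ⟨m, x, rfl⟩ := Set.mem_iUnion.mp hz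
      simpa using hE m x
  rw [this]; rfl

theorem repr (V : AffineVirasoro g L) (w : L) : ∃ (f : ℤ →₀ g) (c : ℤ →₀ ℂ) (a b : ℂ),
    w = (f.sum fun m x => V.E m x) + (c.sum fun m t => t • V.d m) + a • V.K₁ + b • V.K₂ := by
  have hw : w ∈ Submodule.span ℂ
    (({V.K₁, V.K₂} : Set L) ∪ Set.range V.d ∪ ⋃ m : ℤ, Set.range (V.E m)) := by
    rw [V.spans]; trivial
  induction hw using Submodule.span_induction with
  | mem z hz =>
    rcases hz with (hz | ⟨m, rfl⟩) | hz
    · rcases hz with rfl | rfl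
      · exact ⟨0, 0, 1, 0, by simp⟩
      · exact ⟨0, 0, 0, 1, by simp⟩
    · exact ⟨0, Finsupp.single m 1, 0, 0, by simp⟩
    · obtain ⟨m, x, rfl⟩ := Set.mem_iUnion.mp hz
      exact ⟨Finsupp.single m x, 0, 0, 0, by simp⟩
  | zero => exact ⟨0, 0, 0, 0, by simp⟩
  | add x y _ _ hx hy =>
    obtain ⟨f, c, a, b, rfl⟩ := hx
    obtain ⟨f', c', a', b', rfl⟩ := hy
    refine ⟨f + f', c + c', a + a', b + b', ?_⟩
    rw [Finsupp.sum_add_index' (by simp) (by simp),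
      Finsupp.sum_add_index' (by simp) (by simp [add_smul]), add_smul, add_smul]
    abel
  | smul s x _ hx =>
    obtain ⟨f, c, a, b, rfl⟩ := hx
    refine ⟨s • f, s • c, s * a, s * b, ?_⟩
    rw [Finsupp.sum_smul_index' (by simp), Finsupp.sum_smul_index' (by simp)]
    simp only [smul_add, Finsupp.smul_sum, map_smul, mul_smul, smul_eq_mul]

theorem eig (V : AffineVirasoro g L) (n : ℤ) (hn : n ≠ 0) (w : L)
    (hw : ⁅V.d 0, w⁆ = (n : ℂ) • w) : ∃ (x : g) (t : ℂ), w = V.E n x + t • V.d n := by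
  obtain ⟨f, c, a, b, rfl⟩ := repr V w
  let f' : ℤ →₀ g := Finsupp.onFinset f.support (fun m => ((m : ℂ) - n) • f m)
    (by intro m hm; rw [Finsupp.mem_support_iff]; intro h; simp [h] at hm)
  let c' : ℤ →₀ ℂ := Finsupp.onFinset c.support (fun m => ((m : ℂ) - n) * c m)
    (by intro m hm; rw [Finsupp.mem_support_iff]; intro h; simp [h] at hm)
  have hf' : (f'.sum fun m x => V.E m x) = ∑ m ∈ f.support, V.E m (((m : ℂ) - n) • f m) :=
    Finsupp.onFinset_sum _ (by simp)
  have hc' : (c'.sum fun m t => t • V.d m) =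
      ∑ m ∈ c.support, (((m : ℂ) - n) * c m) • V.d m :=
    Finsupp.onFinset_sum _ (by simp)
  have hdd : ∀ m, ⁅V.d 0, V.d m⁆ = (m : ℂ) • V.d m := by
    intro m; rw [V.bracket_dd]; simp
  have cm : ∀ m, c m • (m : ℂ) • V.d m = (m : ℂ) • c m • V.d m := fun m => smul_comm _ _ _
  have hz := V.indep f' c' (-(n * a)) (-(n * b)) (by
    rw [hf', hc']
    rw [← sub_eq_zero] at hw
    rw [← hw]
    simp only [Finsupp.sum, lie_add, lie_smul, V.central_K₁, V.central_K₂, lie_sum, V.bracket_dE,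
      hdd, zero_add, smul_add, Finset.smul_sum, map_smul, map_sub, sub_smul, sub_mul, mul_smul, neg_smul,
      Finset.sum_sub_distrib, smul_zero, add_zero]
    simp only [cm]
    abel)
  obtain ⟨z1, z2, z3, z4⟩ := hz
  have hnC : (n : ℂ) ≠ 0 := by exact_mod_cast hn
  have ha : a = 0 := by simpa [hn] using z3
  have hb : b = 0 := by simpa [hn] using z4
  have hfs : f = Finsupp.single n (f n) := by
    ext m
    by_cases h : m = n
    · subst h; simp
    · rw [Finsupp.single_eq_of_ne h]
      have := DFunLike.congr_fun z1 m
      have h3 : ((m : ℂ) - n) ≠ 0 := by rw [sub_ne_zero]; exact_mod_cast h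
      have h4 : ((m : ℂ) - n) • f m = 0 := this
      exact (smul_eq_zero.mp h4).resolve_left h3
  have hcs : c = Finsupp.single n (c n) := by
    ext m
    by_cases h : m = n
    · subst h; simp
    · rw [Finsupp.single_eq_of_ne h]
      have := DFunLike.congr_fun z2 m
      have h3 : ((m : ℂ) - n) ≠ 0 := by rw [sub_ne_zero]; exact_mod_cast h
      have h4 : ((m : ℂ) - n) • c m = 0 := this
      exact (smul_eq_zero.mp h4).resolve_left h3
  refine ⟨f n, c n, ?_⟩
  rw [hfs, hcs, ha, hb]
  simp

theorem indep1 (V : AffineVirasoro g L) (n : ℤ) (x : g) (t : ℂ)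
    (h : V.E n x + t • V.d n = 0) : x = 0 ∧ t = 0 := by
  have := V.indep (Finsupp.single n x) (Finsupp.single n t) 0 0 (by simpa using h)
  exact ⟨by simpa using this.1, by simpa using this.2.1⟩

theorem indep2 (V : AffineVirasoro g L) (n : ℤ) (x y : g) (t s : ℂ)
    (h : V.E n x + t • V.d n = V.E n y + s • V.d n) : x = y ∧ t = s := by
  have := indep1 V n (x - y) (t - s) (by
    rw [map_sub, sub_smul, ← sub_eq_zero.mpr h]; abel)
  exact ⟨sub_eq_zero.mp this.1, sub_eq_zero.mp this.2⟩

end AffVirProof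

open AffVirProof in
/-- Every skew-symmetric biderivation of the affine-Virasoro Lie algebra is inner. -/
theorem affineVirasoro_skew_biderivation_inner (g L : Type*) [LieRing g] [LieAlgebra ℂ g] [LieAlgebra.IsSimple ℂ g] [FiniteDimensional ℂ g] [LieRing L] [LieAlgebra ℂ L] (V : AffineVirasoro g L)
    (F : L →ₗ[ℂ] L →ₗ[ℂ] L)
    (hskew : ∀ x y : L, F x y = - F y x)
    (h1 : ∀ x y z : L, F ⁅x, y⁆ z = ⁅x, F y z⁆ - ⁅y, F x z⁆)
    (h2 : ∀ x y z : L, F x ⁅y, z⁆ = ⁅y, F x z⁆ - ⁅z, F x y⁆) :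
    ∃ lam : ℂ, ∀ x y : L, F x y = lam • ⁅x, y⁆ := by
  have hkey := key F hskew h1 h2
  have hself : ∀ x, F x x = 0 := fun x => self_neg (hskew x x)
  have hdd : ∀ m, ⁅V.d 0, V.d m⁆ = (m : ℂ) • V.d m := by
    intro m; rw [V.bracket_dd]; simp
  have hdE : ∀ m x, ⁅V.d 0, V.E m x⁆ = (m : ℂ) • V.E m x := by
    intro m x; rw [V.bracket_dE]; simp
  have hdd' : ∀ m n, m + n ≠ 0 → ⁅V.d m, V.d n⁆ = ((n : ℂ) - m) • V.d (m + n) := by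
    intro m n h; rw [V.bracket_dd]; simp [h]
  have hEd : ∀ m n x, ⁅V.E m x, V.d n⁆ = -((m : ℂ) • V.E (m + n) x) := by
    intro m n x; rw [← lie_skew, V.bracket_dE, add_comm]
  have hcomm : ∀ v, F (V.d 0) ⁅V.d 0, v⁆ = ⁅V.d 0, F (V.d 0) v⁆ := by
    intro v; rw [h2, hself]; simp
  have heig : ∀ (n : ℤ) v, n ≠ 0 → ⁅V.d 0, v⁆ = (n : ℂ) • v →
      ∃ (x : g) (t : ℂ), F (V.d 0) v = V.E n x + t • V.d n := by
    intro n v hn hv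
    apply eig V n hn
    rw [← hcomm, hv, map_smul]
  have hC : ∀ n : ℤ, n ≠ 0 → (n : ℂ) ≠ 0 := fun n hn => by exact_mod_cast hn
  -- action on d
  have hd1 : ∀ n : ℤ, n ≠ 0 → ∃ t : ℂ, F (V.d 0) (V.d n) = t • V.d n := by
    intro n hn
    obtain ⟨x, t, h⟩ := heig n (V.d n) hn (hdd n)
    refine ⟨t, ?_⟩
    have k := hkey (V.d 0) (V.d n) (V.d 0) (V.d n)
    rw [hdd, h] at k
    simp only [lie_smul, smul_lie, add_lie, lie_add, lie_self, smul_zero, add_zero, hEd,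
      V.bracket_dE] at k
    have k2 : V.E (n + n) ((-(n * n + n * n) : ℂ) • x) + (0 : ℂ) • V.d (n + n) = 0 := by
      rw [← sub_eq_zero.mpr k]
      simp only [map_smul]
      module
    have k3 := (indep1 V _ _ _ k2).1
    have hx : x = 0 := by
      refine (smul_eq_zero.mp k3).resolve_left ?_
      have := hC n hn
      intro h
      apply mul_ne_zero this this
      linear_combination (-1/2 : ℂ) * h
    rw [h, hx]; simp
  choose! c hc using hd1
  -- action on E
  have hE1 : ∀ n : ℤ, n ≠ 0 → ∀ x, ∃ y : g, F (V.d 0) (V.E n x) = V.E n y := by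
    intro n hn x
    obtain ⟨y, t, h⟩ := heig n (V.E n x) hn (hdE n x)
    refine ⟨y, ?_⟩
    have h2n : 2 * n ≠ 0 := by omega
    have k := hkey (V.d 0) (V.d (2 * n)) (V.d 0) (V.E n x)
    rw [hdd, hdE, h, hc _ h2n] at k
    simp only [lie_smul, smul_lie, lie_add, V.bracket_dE, hdd' (2 * n) n (by omega)] at k
    have k2 := indep2 V (2 * n + n) ((((c (2 * n))) * (n * n) : ℂ) • x)
      ((((2 * n : ℤ) : ℂ) * n) • y) 0 (((2 * n : ℤ) : ℂ) * (t * (n - ((2 * n : ℤ) : ℂ)))) (by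
        simp only [map_smul]
        rw [← sub_eq_zero] at k ⊢; rw [← k]; module)
    have hn' := hC n hn
    have ht : t = 0 := by
      have := k2.2
      push_cast at this
      have h3 : (n : ℂ) * n * t = 0 := by linear_combination (1/2 : ℂ) * this
      simpa [hn] using h3
    rw [h, ht]; simp
  have hE2 : ∀ m n : ℤ, m ≠ 0 → n ≠ 0 → ∀ x y, F (V.d 0) (V.E n x) = V.E n y →
      (n * c m : ℂ) • x = (m : ℂ) • y := by
    intro m n hm hn x y h
    have k := hkey (V.d 0) (V.d m) (V.d 0) (V.E n x)
    rw [hdd, hdE, h, hc _ hm] at k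
    simp only [lie_smul, smul_lie, V.bracket_dE] at k
    have k2 := indep2 V (m + n) ((n : ℂ) • (n * c m : ℂ) • x) ((n : ℂ) • (m : ℂ) • y) 0 0 (by
        simp only [map_smul]
        rw [← sub_eq_zero] at k ⊢; rw [← k]; module)
    exact smul_right_injective g (hC n hn) k2.1
  set lam := c 1 with hlam
  have hE3 : ∀ n : ℤ, n ≠ 0 → ∀ x, F (V.d 0) (V.E n x) = lam • (n : ℂ) • V.E n x := by
    intro n hn x
    obtain ⟨y, hy⟩ := hE1 n hn x
    have := hE2 1 n one_ne_zero hn x y hy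
    rw [Int.cast_one, one_smul] at this
    rw [hy, ← this, map_smul, smul_smul, mul_comm]
  have hnt : ∃ x : g, x ≠ 0 := by
    by_contra! hcon
    apply LieAlgebra.IsSimple.non_abelian (R := ℂ) (L := g)
    constructor
    intro x y
    rw [hcon x]; simp
  obtain ⟨x0, hx0⟩ := hnt
  have hd3 : ∀ n : ℤ, n ≠ 0 → F (V.d 0) (V.d n) = lam • (n : ℂ) • V.d n := by
    intro n hn
    have := hE2 n 1 hn one_ne_zero x0 (lam • x0) (by rw [hE3 1 one_ne_zero]; simp)
    rw [Int.cast_one, one_mul, smul_smul] at this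
    rw [hc n hn, smul_left_injective ℂ hx0 this, mul_comm, mul_smul]
  refine ⟨lam, ?_⟩
  let G : L →ₗ[ℂ] L →ₗ[ℂ] L := F - lam • (LieModule.toEnd ℂ L L : L →ₗ[ℂ] Module.End ℂ L)
  have hG : ∀ x y, G x y = F x y - lam • ⁅x, y⁆ := fun x y => rfl
  have hcen0 : ∀ (n : ℤ) v, n ≠ 0 → ⁅V.d 0, v⁆ = (n : ℂ) • v →
      F (V.d 0) v = lam • (n : ℂ) • v → ∀ x y, ⁅G x y, v⁆ = 0 := by
    intro n v hn hv hv2 x y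
    have k := hkey x y (V.d 0) v
    rw [hv, hv2, lie_smul, lie_smul, lie_smul, smul_comm] at k
    have := smul_right_injective L (hC n hn) k
    rw [hG, sub_lie, smul_lie]
    exact sub_eq_zero.mpr this
  have hcE : ∀ n : ℤ, n ≠ 0 → ∀ z x y, ⁅G x y, V.E n z⁆ = 0 := fun n hn z =>
    hcen0 n _ hn (hdE n z) (hE3 n hn z)
  have hcd : ∀ n : ℤ, n ≠ 0 → ∀ x y, ⁅G x y, V.d n⁆ = 0 := fun n hn =>
    hcen0 n _ hn (hdd n) (hd3 n hn)
  have eE0 : ∀ z, V.E 0 z = ⁅V.d (-1), V.E 1 z⁆ := by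
    intro z; rw [V.bracket_dE]; simp
  have ed0 : V.d 0 = (-1/2 : ℂ) • ⁅V.d 1, V.d (-1)⁆ := by
    rw [V.bracket_dd]; simp [smul_smul]; norm_num
  have hcen : ∀ x y v : L, ⁅G x y, v⁆ = 0 := by
    intro x y v
    refine ext_gen V (LieModule.toEnd ℂ L L (G x y)) ?_ ?_ (V.central_K₁ _) (V.central_K₂ _) v
    · intro m z
      rw [LieModule.toEnd_apply_apply]
      by_cases hm : m = 0
      · subst hm
        rw [eE0, leibniz_lie, hcE 1 one_ne_zero, hcd (-1) (by norm_num)]; simp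
      · exact hcE m hm z x y
    · intro m
      rw [LieModule.toEnd_apply_apply]
      by_cases hm : m = 0
      · subst hm
        rw [ed0, lie_smul, leibniz_lie, hcd 1 one_ne_zero, hcd (-1) (by norm_num)]; simp
      · exact hcd m hm x y
  have hcen' : ∀ x y v : L, ⁅v, G x y⁆ = 0 := by
    intro x y v; rw [← lie_skew, hcen, neg_zero]
  have hGb : ∀ x y z : L, G ⁅x, y⁆ z = 0 := by
    intro x y z
    have : G ⁅x, y⁆ z = ⁅x, G y z⁆ - ⁅y, G x z⁆ := by
      simp only [hG, h1, lie_sub, lie_smul, lie_lie, smul_sub]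
      abel
    rw [this, hcen', hcen', sub_zero]
  have hGs : ∀ x y, G x y = - G y x := by
    intro x y
    rw [hG, hG, hskew x y, ← lie_skew x y, smul_neg]; abel
  have hGE : ∀ m x z, G (V.E m x) z = 0 := by
    intro m x z
    have : V.E m x = ⁅V.d (m - 1), V.E 1 x⁆ := by rw [V.bracket_dE]; simp
    rw [this, hGb]
  have hGd : ∀ m z, G (V.d m) z = 0 := by
    intro m z
    by_cases hm : m = 0
    · subst hm; rw [ed0, map_smul, LinearMap.smul_apply, hGb, smul_zero]
    · have : V.d m = (m : ℂ)⁻¹ • ⁅V.d 0, V.d m⁆ := by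
        rw [hdd, smul_smul, inv_mul_cancel₀ (hC m hm), one_smul]
      rw [this, map_smul, LinearMap.smul_apply, hGb, smul_zero]
  have hGK2 : ∀ z, G V.K₂ z = 0 := by
    intro z
    have : V.K₂ = (2 : ℂ) • (⁅V.d 2, V.d (-2)⁆ + (4 : ℂ) • V.d 0) := by
      rw [V.bracket_dd]; simp only [add_neg_cancel, if_true]; push_cast; module
    rw [this, map_smul, map_add, map_smul]
    simp [hGb, hGd]
  have hGK1 : ∀ z, G V.K₁ z = 0 := by
    refine ext_gen V (G V.K₁) ?_ ?_ ?_ ?_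
    · intro m x; rw [hGs, hGE, neg_zero]
    · intro m; rw [hGs, hGd, neg_zero]
    · exact self_neg (hGs _ _)
    · rw [hGs, hGK2, neg_zero]
  have hG0 : ∀ x, G x = 0 := ext_gen V G
    (fun m x => LinearMap.ext (hGE m x)) (fun m => LinearMap.ext (hGd m))
    (LinearMap.ext hGK1) (LinearMap.ext hGK2)
  intro x y
  have := hG x y
  rw [hG0] at this
  exact sub_eq_zero.mp this.symm
end

section
/- Let $L$ be a finite-dimensional semisimple complex Lie algebra and $V$ a finite-dimensional $L$-module. Then every symmetric biderivation $\delta: L \times L \to V$ is zero. -/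
open LieAlgebra LieModule

section core

variable {L : Type*} [LieRing L] [LieAlgebra ℂ L]
  {V : Type*} [AddCommGroup V] [Module ℂ V] [LieRingModule L V] [LieModule ℂ L V]

lemma bider_core_s16 {ι : Type*} [Fintype ι] (a b : ι → L)
    (inv : ∀ (z : L) (F : L →ₗ[ℂ] L →ₗ[ℂ] V),
      ∑ i, F ⁅z, a i⁆ (b i) + ∑ i, F (a i) ⁅z, b i⁆ = 0)
    (sym : ∀ (F : L →ₗ[ℂ] L →ₗ[ℂ] V), ∑ i, F (a i) (b i) = ∑ i, F (b i) (a i))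
    (Cinj : ∀ m : V, ∑ i, ⁅a i, ⁅b i, m⁆⁆ = 0 → m = 0)
    (perf : ∀ v : V, (∀ x y : L, ⁅⁅x, y⁆, v⁆ = 0) → ∀ x : L, ⁅x, v⁆ = 0)
    (δ : L →ₗ[ℂ] L →ₗ[ℂ] V)
    (hsymm : ∀ x y : L, δ x y = δ y x)
    (hder : ∀ x z y : L, δ ⁅x, z⁆ y = ⁅x, δ z y⁆ - ⁅z, δ x y⁆) :
    δ = 0 := by
  let T : L →ₗ[ℂ] V →ₗ[ℂ] V := (toEnd ℂ L V : L →ₗ[ℂ] Module.End ℂ V)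
  have hT : ∀ x m, T x m = ⁅x, m⁆ := fun _ _ => rfl
  -- Casimir commutes
  have h1 : ∀ (z : L) (m : V), ∑ i, ⁅a i, ⁅b i, ⁅z, m⁆⁆⁆ = ⁅z, ∑ i, ⁅a i, ⁅b i, m⁆⁆⁆ := by
    intro z m
    have := inv z (T.compl₂ (T.flip m))
    simp only [LinearMap.compl₂_apply, LinearMap.flip_apply, hT] at this
    rw [← Finset.sum_add_distrib] at this
    rw [lie_sum, ← sub_eq_zero, ← Finset.sum_sub_distrib, ← neg_eq_zero, ← this,
      ← Finset.sum_neg_distrib]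
    refine Finset.sum_congr rfl fun i _ => ?_
    simp only [lie_lie, lie_sub]
    abel
  let ψ : L →ₗ[ℂ] V := ∑ i, (T (a i)) ∘ₗ (δ (b i))
  have hψ : ∀ y, ψ y = ∑ i, ⁅a i, δ (b i) y⁆ := by
    intro y; simp [ψ, hT]
  have h2 : ∀ z y, ∑ i, ⁅a i, ⁅b i, δ z y⁆⁆ = ⁅z, ψ y⁆ := by
    intro z y
    have := inv z (T.compl₂ (δ.flip y))
    simp only [LinearMap.compl₂_apply, LinearMap.flip_apply, hT] at this
    rw [← Finset.sum_add_distrib] at this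
    rw [hψ, lie_sum, ← sub_eq_zero, ← Finset.sum_sub_distrib, ← neg_eq_zero, ← this,
      ← Finset.sum_neg_distrib]
    refine Finset.sum_congr rfl fun i _ => ?_
    simp only [lie_lie, lie_sub, hder]
    abel
  have h3 : ∀ z y, ⁅z, ψ y⁆ = ⁅y, ψ z⁆ := by
    intro z y
    rw [← h2, ← h2, hsymm]
  let v : V := ∑ i, ⁅a i, ψ (b i)⁆
  have h4 : ∀ y, ∑ i, ⁅a i, ⁅b i, ψ y⁆⁆ = ⁅y, v⁆ := by
    intro y
    have e1 := inv y (T.compl₂ ψ)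
    have e2 := sym ((T.compl₂ ψ).compl₂ (toEnd ℂ L L y))
    simp only [LinearMap.compl₂_apply, hT, toEnd_apply_apply] at e1 e2
    have e3 : ∑ i, ⁅⁅y, a i⁆, ψ (b i)⁆ = ∑ i, ⁅a i, ψ ⁅y, b i⁆⁆ := by
      rw [e2]
      exact Finset.sum_congr rfl fun i _ => h3 _ _
    have e4 : ∑ i, ⁅⁅y, a i⁆, ψ (b i)⁆ = 0 := by
      rw [← e3, ← two_smul ℂ] at e1
      exact (smul_eq_zero.mp e1).resolve_left two_ne_zero
    have : ∑ i, ⁅a i, ⁅b i, ψ y⁆⁆ = ⁅y, v⁆ - ∑ i, ⁅⁅y, a i⁆, ψ (b i)⁆ := by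
      rw [lie_sum, ← Finset.sum_sub_distrib]
      refine Finset.sum_congr rfl fun i _ => ?_
      rw [h3 (b i) y, lie_lie]
      abel
    rw [this, e4, sub_zero]
  have h5 : ∀ z y, ∑ i, ⁅a i, ⁅b i, ∑ j, ⁅a j, ⁅b j, δ z y⁆⁆⁆⁆ = ⁅z, ⁅y, v⁆⁆ := by
    intro z y
    rw [h2, h1, h4]
  have h6 : ∀ x : L, ⁅x, v⁆ = 0 := by
    apply perf
    intro x y
    rw [lie_lie, ← h5, ← h5, hsymm, sub_self]
  ext z y
  apply Cinj
  apply Cinj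
  rw [h5, h6, lie_zero]

/-- dual basis expansions -/
lemma dual_inv_sym {I : Type*} [AddCommGroup I] [Module ℂ I] [FiniteDimensional ℂ I]
    {W : Type*} [AddCommGroup W] [Module ℂ W]
    (B : LinearMap.BilinForm ℂ I) (hB : B.Nondegenerate) (hs : B.IsSymm) :
    ∃ (n : ℕ) (a b : Fin n → I), n = Module.finrank ℂ I ∧ (∀ i, B (a i) (b i) = 1) ∧
      (∀ (D : I →ₗ[ℂ] I), (∀ x y, B (D x) y + B x (D y) = 0) → ∀ (F : I →ₗ[ℂ] I →ₗ[ℂ] W),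
        ∑ i, F (D (a i)) (b i) + ∑ i, F (a i) (D (b i)) = 0) ∧
      (∀ (F : I →ₗ[ℂ] I →ₗ[ℂ] W), ∑ i, F (a i) (b i) = ∑ i, F (b i) (a i)) := by
  classical
  let a := Module.finBasis ℂ I
  let b := B.dualBasis hB a
  have hab : ∀ i j, B (b i) (a j) = if j = i then 1 else 0 :=
    fun i j => B.apply_dualBasis_left hB a i j
  have hba : ∀ i j, B (a j) (b i) = if j = i then 1 else 0 := by
    intro i j; rw [← hab i j]; exact hs.eq _ _
  have hsy : ∀ x y, B x y = B y x := fun x y => hs.eq x y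
  have ha : ∀ x, x = ∑ j, B (b j) x • a j := by
    intro x
    conv_lhs => rw [← a.sum_repr x]
    refine Finset.sum_congr rfl fun j _ => ?_
    congr 1
    have := congrArg (B (b j)) (a.sum_repr x)
    rw [← this]
    simp [hab, -Module.Basis.sum_repr]
  have hb : ∀ x, x = ∑ j, B (a j) x • b j := by
    intro x
    conv_lhs => rw [← b.sum_repr x]
    refine Finset.sum_congr rfl fun j _ => ?_
    congr 1
    have := congrArg (B (a j)) (b.sum_repr x)
    rw [← this]
    simp [hba, -Module.Basis.sum_repr]
  refine ⟨_, a, b, rfl, by simp [hba, -Module.Basis.sum_repr], ?_, ?_⟩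
  · intro D hD F
    have e1 : ∑ i, F (D (a i)) (b i) = ∑ i, ∑ j, B (b j) (D (a i)) • F (a j) (b i) := by
      refine Finset.sum_congr rfl fun i _ => ?_
      conv_lhs => rw [ha (D (a i))]
      simp
    have e2 : ∑ i, F (a i) (D (b i)) = ∑ i, ∑ j, B (a j) (D (b i)) • F (a i) (b j) := by
      refine Finset.sum_congr rfl fun i _ => ?_
      conv_lhs => rw [hb (D (b i))]
      simp
    rw [e1, e2, Finset.sum_comm, ← Finset.sum_add_distrib]
    refine Finset.sum_eq_zero fun i _ => ?_
    rw [← Finset.sum_add_distrib]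
    refine Finset.sum_eq_zero fun j _ => ?_
    rw [← add_smul, hsy (b i) (D (a j)), hD, zero_smul]
  · intro F
    have e1 : ∑ i, F (a i) (b i) = ∑ i, ∑ j, B (b j) (b i) • F (a i) (a j) := by
      refine Finset.sum_congr rfl fun i _ => ?_
      conv_lhs => rw [ha (b i)]
      simp
    have e2 : ∑ i, F (b i) (a i) = ∑ i, ∑ j, B (b j) (b i) • F (a j) (a i) := by
      refine Finset.sum_congr rfl fun i _ => ?_
      conv_lhs => rw [ha (b i)]
      simp
    rw [e1, e2, Finset.sum_comm]
    refine Finset.sum_congr rfl fun i _ => Finset.sum_congr rfl fun j _ => ?_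
    rw [hsy (b i)]

end core

section ss

variable {L : Type*} [LieRing L] [LieAlgebra ℂ L] [FiniteDimensional ℂ L]
    [LieAlgebra.IsSemisimple ℂ L]

lemma ss_perfect : (⁅(⊤ : LieIdeal ℂ L), (⊤ : LieIdeal ℂ L)⁆ : LieIdeal ℂ L) = ⊤ := by
  rw [eq_top_iff, ← IsSemisimple.sSup_atoms_eq_top (R := ℂ) (L := L)]
  apply sSup_le
  intro I hI
  have h : ⁅I, I⁆ ≤ ⁅(⊤ : LieIdeal ℂ L), (⊤ : LieIdeal ℂ L)⁆ :=
    LieSubmodule.mono_lie le_top le_top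
  have h1 : ⁅I, I⁆ ≤ I := LieSubmodule.lie_le_left I I
  rcases hI.le_iff.mp h1 with h2 | h2
  · exact absurd ((LieSubmodule.lie_abelian_iff_lie_self_eq_bot I).mpr h2)
      (IsSemisimple.non_abelian_of_isAtom I hI)
  · rw [IsSemisimple.sSup_atoms_eq_top]
    exact h2 ▸ h

lemma ss_perfect_lin {W : Type*} [AddCommGroup W] [Module ℂ W] (f : L →ₗ[ℂ] W)
    (hf : ∀ x y : L, f ⁅x, y⁆ = 0) : f = 0 := by
  have h : (⊤ : Submodule ℂ L) ≤ LinearMap.ker f := by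
    have h1 : LieSubmodule.toSubmodule (⁅(⊤ : LieIdeal ℂ L), (⊤ : LieIdeal ℂ L)⁆ : LieIdeal ℂ L) = ⊤ := by
      rw [ss_perfect]; rfl
    rw [← h1, LieSubmodule.lieIdeal_oper_eq_linear_span', Submodule.span_le]
    rintro _ ⟨x, -, y, -, rfl⟩
    exact hf x y
  ext x
  exact h (Submodule.mem_top (x := x))

variable {V : Type*} [AddCommGroup V] [Module ℂ V] [LieRingModule L V] [LieModule ℂ L V]
    [FiniteDimensional ℂ V]

lemma bider_irred [LieModule.IsIrreducible ℂ L V]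
    (δ : L →ₗ[ℂ] L →ₗ[ℂ] V)
    (hsymm : ∀ x y : L, δ x y = δ y x)
    (hder : ∀ x z y : L, δ ⁅x, z⁆ y = ⁅x, δ z y⁆ - ⁅z, δ x y⁆) :
    δ = 0 := by
  by_cases htriv : ∀ I : LieIdeal ℂ L, IsAtom I → ∀ x ∈ I, ∀ m : V, ⁅x, m⁆ = 0
  · have h : ∀ (x : L) (m : V), ⁅x, m⁆ = 0 := by
      have : (⊤ : LieIdeal ℂ L) ≤ LieModule.ker ℂ L V := by
        rw [← IsSemisimple.sSup_atoms_eq_top (R := ℂ) (L := L)]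
        apply sSup_le
        intro I hI x hx
        rw [LieModule.mem_ker]
        exact htriv I hI x hx
      intro x m
      exact (LieModule.mem_ker ℂ L V x).mp (this (LieSubmodule.mem_top x)) m
    apply ss_perfect_lin
    intro x y
    ext z
    rw [hder, h, h]; simp
  push Not at htriv
  obtain ⟨I, hI, x₀, hx₀, m₀, hxm⟩ := htriv
  have : LieAlgebra.IsSimple ℂ I := IsSemisimple.isSimple_of_isAtom I hI
  let B := LieModule.traceForm ℂ I V
  have hBs : B.IsSymm := ⟨LieModule.traceForm_comm ℂ I V⟩
  have hBL : ∀ x y : I, B x y = LieModule.traceForm ℂ L V x y := fun _ _ => rfl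
  have hB0 : B ≠ 0 := by
    intro h0
    have hn := LieModule.isNilpotent_derivedSeries_of_traceForm_eq_zero h0
    have hd : derivedSeries ℂ I 1 = ⊤ := by
      rcases IsSimple.eq_bot_or_eq_top (derivedSeries ℂ I 1) with h | h
      · exfalso
        apply IsSimple.non_abelian ℂ (L := I)
        refine ⟨fun x y => ?_⟩
        have hxy : ⁅x, y⁆ ∈ derivedSeries ℂ I 1 :=
          LieSubmodule.lie_mem_lie (LieSubmodule.mem_top x) (LieSubmodule.mem_top y)
        rw [h, LieSubmodule.mem_bot] at hxy
        exact hxy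
      · exact h
    have : Nontrivial V := LieModule.nontrivial_of_isIrreducible ℂ L V
    have hnt := LieModule.nontrivial_max_triv_of_isNilpotent ℂ (derivedSeries ℂ I 1) V
    let N : LieSubmodule ℂ L V :=
      { carrier := {m | ∀ x ∈ I, ⁅x, m⁆ = 0}
        add_mem' := by
          intro p q hp hq x hx
          rw [lie_add, hp x hx, hq x hx, add_zero]
        zero_mem' := by intro x _; simp
        smul_mem' := by
          intro c p hp x hx
          rw [lie_smul, hp x hx, smul_zero]
        lie_mem := by
          intro z m hm x hx
          rw [leibniz_lie, hm x hx, lie_zero, add_zero]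
          exact hm _ (lie_mem_left ℂ L I x z hx) }
    obtain ⟨⟨m, hm⟩, hmne⟩ := exists_ne (0 : LieModule.maxTrivSubmodule ℂ (derivedSeries ℂ I 1) V)
    have hmN : m ∈ N := by
      intro x hx
      have h1 : (⟨x, hx⟩ : I) ∈ derivedSeries ℂ I 1 := by rw [hd]; exact LieSubmodule.mem_top _
      exact (LieModule.mem_maxTrivSubmodule _ _ _ m).mp hm ⟨⟨x, hx⟩, h1⟩
    have hN : N = ⊤ := by
      rcases eq_bot_or_eq_top N with h | h
      · exfalso
        apply hmne
        rw [h, LieSubmodule.mem_bot] at hmN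
        exact Subtype.ext hmN
      · exact h
    have : m₀ ∈ N := by rw [hN]; exact LieSubmodule.mem_top _
    exact hxm (this x₀ hx₀)
  have hBn : B.Nondegenerate := by
    rw [LinearMap.BilinForm.nondegenerate_iff_ker_eq_bot]
    let J : LieIdeal ℂ I :=
      { LinearMap.ker B with
        lie_mem := by
          intro x m hm
          change B ⁅x, m⁆ = 0
          have hm : B m = 0 := hm
          ext y
          rw [LieModule.traceForm_apply_lie_apply']
          change - B m _ = 0
          rw [hm]; simp }
    rcases IsSimple.eq_bot_or_eq_top J with h | h
    · have := congrArg LieSubmodule.toSubmodule h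
      exact this
    · exfalso
      apply hB0
      have := congrArg LieSubmodule.toSubmodule h
      exact LinearMap.ker_eq_top.mp this
  obtain ⟨n, a, b, hn, hab, hinv, hsym⟩ := dual_inv_sym (W := V) B hBn hBs
  let ad : L → I →ₗ[ℂ] I := fun z => (toEnd ℂ L I z)
  have hI0 : (n : ℂ) ≠ 0 := by
    have : Nontrivial I := LieAlgebra.IsSimple.nontrivial ℂ I
    rw [hn]
    exact_mod_cast Module.finrank_pos.ne'
  let ic : I →ₗ[ℂ] L := I.toSubmodule.subtype
  have hinv' : ∀ (z : L) (F : L →ₗ[ℂ] L →ₗ[ℂ] V),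
      ∑ i, F ⁅z, (a i : L)⁆ (b i) + ∑ i, F (a i) ⁅z, (b i : L)⁆ = 0 := by
    intro z F
    refine hinv (ad z) ?_ (F.compl₁₂ ic ic)
    intro x y
    change LieModule.traceForm ℂ L V ⁅z, (x : L)⁆ y + LieModule.traceForm ℂ L V x ⁅z, (y : L)⁆ = 0
    rw [LieModule.traceForm_apply_lie_apply']; simp
  have hsym' : ∀ (F : L →ₗ[ℂ] L →ₗ[ℂ] V),
      ∑ i, F (a i) (b i) = ∑ i, F (b i) (a i) := fun F => hsym (F.compl₁₂ ic ic)
  let C : V →ₗ[ℂ] V := ∑ i, toEnd ℂ L V (a i) ∘ₗ toEnd ℂ L V (b i)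
  have hC : ∀ m, C m = ∑ i, ⁅(a i : L), ⁅(b i : L), m⁆⁆ := by intro m; simp [C]
  have hCtr : LinearMap.trace ℂ V C = n := by
    have : ∀ i, LinearMap.trace ℂ V (toEnd ℂ L V (a i) ∘ₗ toEnd ℂ L V (b i)) = 1 := hab
    simp [C, map_sum, this]
  let T : L →ₗ[ℂ] V →ₗ[ℂ] V := (toEnd ℂ L V : L →ₗ[ℂ] Module.End ℂ V)
  have hT : ∀ x m, T x m = ⁅x, m⁆ := fun _ _ => rfl
  have hcomm : ∀ (z : L) (m : V), C ⁅z, m⁆ = ⁅z, C m⁆ := by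
    intro z m
    have := hinv' z (T.compl₂ (T.flip m))
    simp only [LinearMap.compl₂_apply, LinearMap.flip_apply, hT] at this
    rw [← Finset.sum_add_distrib] at this
    rw [hC, hC, lie_sum, ← sub_eq_zero, ← Finset.sum_sub_distrib, ← neg_eq_zero, ← this,
      ← Finset.sum_neg_distrib]
    refine Finset.sum_congr rfl fun i _ => ?_
    simp only [lie_lie, lie_sub]
    abel
  let K : LieSubmodule ℂ L V :=
    { LinearMap.ker C with
      lie_mem := by
        intro x m hm
        change C ⁅x, m⁆ = 0
        have hm : C m = 0 := hm
        rw [hcomm, hm, lie_zero] }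
  have hK : K = ⊥ := by
    rcases eq_bot_or_eq_top K with h | h
    · exact h
    · exfalso
      have h1 : LinearMap.ker C = ⊤ := congrArg LieSubmodule.toSubmodule h
      rw [LinearMap.ker_eq_top] at h1
      rw [h1, map_zero] at hCtr
      exact hI0 hCtr.symm
  refine bider_core_s16 (fun i => (a i : L)) (fun i => (b i : L)) hinv' hsym' ?_ ?_ δ hsymm hder
  · intro m hm
    rw [← hC] at hm
    have : m ∈ K := hm
    rw [hK] at this
    exact (LieSubmodule.mem_bot m).mp this
  · intro v hv x
    have := ss_perfect_lin (T.flip v) hv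
    exact LinearMap.congr_fun this x

end ss

lemma bider_aux
    (L : Type*) [LieRing L] [LieAlgebra ℂ L] [FiniteDimensional ℂ L]
    [LieAlgebra.IsSemisimple ℂ L] (n : ℕ) :
    ∀ (V : Type*) [AddCommGroup V] [Module ℂ V] [LieRingModule L V] [LieModule ℂ L V]
    [FiniteDimensional ℂ V] (_ : Module.finrank ℂ V = n)
    (δ : L →ₗ[ℂ] L →ₗ[ℂ] V)
    (_ : ∀ x y : L, δ x y = δ y x)
    (_ : ∀ x z y : L, δ ⁅x, z⁆ y = ⁅x, δ z y⁆ - ⁅z, δ x y⁆),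
    δ = 0 := by
  induction n using Nat.strong_induction_on with
  | _ n ih =>
  intro V _ _ _ _ _ hn δ hsymm hder
  rcases subsingleton_or_nontrivial V with hV | hV
  · ext x y; exact Subsingleton.elim _ _
  by_cases hirr : ∀ N : LieSubmodule ℂ L V, N ≠ ⊥ → N = ⊤
  · have := LieModule.IsIrreducible.mk hirr
    exact bider_irred δ hsymm hder
  push Not at hirr
  obtain ⟨N, hN0, hN1⟩ := hirr
  have hN0' : N.toSubmodule ≠ ⊥ := by simpa using hN0
  have hN1' : N.toSubmodule ≠ ⊤ := by simpa using hN1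
  have hq : Module.finrank ℂ (V ⧸ N) < n := by
    have h1 := N.toSubmodule.finrank_quotient_add_finrank
    have h2 := Submodule.one_le_finrank_iff.mpr hN0'
    change Module.finrank ℂ (V ⧸ N.toSubmodule) < n
    omega
  have hs : Module.finrank ℂ N < n := by
    have := Submodule.finrank_lt (lt_top_iff_ne_top.mpr hN1').ne
    rw [← hn]; exact this
  have h1 := ih _ hq (V ⧸ N) rfl
    (δ.compr₂ (LieSubmodule.Quotient.mk' N : V →ₗ[ℂ] V ⧸ N))
    (by intro x y; simp only [LinearMap.compr₂_apply]; rw [hsymm])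
    (by intro x z y; simp only [LinearMap.compr₂_apply]; rw [hder, map_sub]; rfl)
  have hmem : ∀ x y, δ x y ∈ N := by
    intro x y
    have := LinearMap.congr_fun (LinearMap.congr_fun h1 x) y
    exact (LieSubmodule.Quotient.mk_eq_zero N).mp this
  let δ' : L →ₗ[ℂ] L →ₗ[ℂ] N := LinearMap.mk₂ ℂ (fun x y => (⟨δ x y, hmem x y⟩ : N))
    (by intros; ext; simp) (by intros; ext; simp) (by intros; ext; simp) (by intros; ext; simp)
  have h2 := ih _ hs N rfl δ'
    (by intro x y; ext; exact hsymm x y)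
    (by intro x z y; ext; exact hder x z y)
  ext x y
  have := LinearMap.congr_fun (LinearMap.congr_fun h2 x) y
  exact congrArg Subtype.val this

/-- Every symmetric biderivation from a finite-dimensional semisimple
complex Lie algebra `L` to a finite-dimensional `L`-module `V` is zero. -/
theorem symmetric_biderivation_semisimple_eq_zero
    (L : Type*) [LieRing L] [LieAlgebra ℂ L] [FiniteDimensional ℂ L]
    [LieAlgebra.IsSemisimple ℂ L]
    (V : Type*) [AddCommGroup V] [Module ℂ V] [LieRingModule L V] [LieModule ℂ L V]
    [FiniteDimensional ℂ V]
    (δ : L →ₗ[ℂ] L →ₗ[ℂ] V)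
    (hsymm : ∀ x y : L, δ x y = δ y x)
    (hder : ∀ x z y : L, δ ⁅x, z⁆ y = ⁅x, δ z y⁆ - ⁅z, δ x y⁆) :
    δ = 0 := by
  exact bider_aux L _ V rfl δ hsymm hder
end

section
/- Let $\mathfrak{g}$ be a finite-dimensional complex simple Lie algebra. Every symmetric biderivation of the affine-Virasoro Lie algebra $\mathfrak{L}(\mathfrak{g})$ is trivial (identically zero). -/
section AVProof

variable {g L : Type*} [LieRing g] [LieAlgebra ℂ g] [LieRing L] [LieAlgebra ℂ L]

theorem AV_ext (V : AffineVirasoro g L) {M : Type*} [AddCommGroup M] [Module ℂ M]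
    (f h : L →ₗ[ℂ] M) (hE : ∀ m x, f (V.E m x) = h (V.E m x)) (hd : ∀ m, f (V.d m) = h (V.d m))
    (h1 : f V.K₁ = h V.K₁) (h2 : f V.K₂ = h V.K₂) : f = h := by
  refine LinearMap.ext_on V.spans ?_
  rintro v ((hv | ⟨m, rfl⟩) | hv)
  · rcases hv with rfl | rfl
    · exact h1
    · exact h2
  · exact hd m
  · obtain ⟨m, x, rfl⟩ := Set.mem_iUnion.1 hv
    exact hE m x

theorem AV_coords (V : AffineVirasoro g L) :
    ∃ (e : ℤ → L →ₗ[ℂ] g) (δ : ℤ → L →ₗ[ℂ] ℂ),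
      (∀ p m x, e p (V.E m x) = if p = m then x else 0) ∧
      (∀ p m, e p (V.d m) = 0) ∧ (∀ p, e p V.K₁ = 0) ∧ (∀ p, e p V.K₂ = 0) ∧
      (∀ p m x, δ p (V.E m x) = 0) ∧
      (∀ p m, δ p (V.d m) = if p = m then 1 else 0) ∧ (∀ p, δ p V.K₁ = 0) ∧ (∀ p, δ p V.K₂ = 0) ∧
      (∀ v, (∀ p, e p v = 0) → (∀ p, δ p v = 0) → ∀ w : L, ⁅w, v⁆ = 0) := by
  classical
  let Φ : ((ℤ →₀ g) × (ℤ →₀ ℂ) × ℂ × ℂ) →ₗ[ℂ] L :=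
    (Finsupp.lsum ℂ V.E).coprod ((Finsupp.linearCombination ℂ V.d).coprod
      ((LinearMap.toSpanSingleton ℂ L V.K₁).coprod (LinearMap.toSpanSingleton ℂ L V.K₂)))
  have hΦ : ∀ f c a b, Φ (f, c, a, b) =
      (f.sum fun m x => V.E m x) + (c.sum fun m t => t • V.d m) + a • V.K₁ + b • V.K₂ := by
    intro f c a b
    simp [Φ, Finsupp.linearCombination_apply, Finsupp.lsum_apply, add_assoc]
  have hinj : Function.Injective Φ := by
    rw [← LinearMap.ker_eq_bot, LinearMap.ker_eq_bot']
    rintro ⟨f, c, a, b⟩ h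
    rw [hΦ] at h
    obtain ⟨rfl, rfl, rfl, rfl⟩ := V.indep f c a b h
    rfl
  have hE : ∀ m x, Φ (Finsupp.single m x, 0, 0, 0) = V.E m x := by
    intro m x; rw [hΦ]; simp
  have hd : ∀ m, Φ (0, Finsupp.single m 1, 0, 0) = V.d m := by
    intro m; rw [hΦ]; simp
  have hK1 : Φ (0, 0, 1, 0) = V.K₁ := by rw [hΦ]; simp
  have hK2 : Φ (0, 0, 0, 1) = V.K₂ := by rw [hΦ]; simp
  have hsurj : Function.Surjective Φ := by
    rw [← LinearMap.range_eq_top, eq_top_iff, ← V.spans, Submodule.span_le]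
    rintro v ((hv | ⟨m, rfl⟩) | hv)
    · rcases hv with rfl | rfl
      · exact ⟨_, hK1⟩
      · exact ⟨_, hK2⟩
    · exact ⟨_, hd m⟩
    · obtain ⟨m, x, rfl⟩ := Set.mem_iUnion.1 hv
      exact ⟨_, hE m x⟩
  let Ψ := LinearEquiv.ofBijective Φ ⟨hinj, hsurj⟩
  have hΨ : ∀ u, Ψ.symm (Φ u) = u := fun u => Ψ.symm_apply_apply u
  refine ⟨fun p => Finsupp.lapply p ∘ₗ LinearMap.fst ℂ _ _ ∘ₗ Ψ.symm.toLinearMap,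
    fun p => Finsupp.lapply p ∘ₗ LinearMap.fst ℂ _ _ ∘ₗ LinearMap.snd ℂ _ _ ∘ₗ Ψ.symm.toLinearMap,
    ?_, ?_, ?_, ?_, ?_, ?_, ?_, ?_, ?_⟩
  · intro p m x; simp [← hE, hΨ, Finsupp.single_apply, eq_comm]
  · intro p m; simp [← hd, hΨ]
  · intro p; simp [← hK1, hΨ]
  · intro p; simp [← hK2, hΨ]
  · intro p m x; simp [← hE, hΨ]
  · intro p m; simp [← hd, hΨ, Finsupp.single_apply, eq_comm]
  · intro p; simp [← hK1, hΨ]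
  · intro p; simp [← hK2, hΨ]
  · intro v h1 h2 w
    obtain ⟨⟨f, c, a, b⟩, rfl⟩ := hsurj v
    have hf : f = 0 := by ext p; simpa [hΨ] using h1 p
    have hc : c = 0 := by ext p; simpa [hΨ] using h2 p
    subst hf; subst hc
    rw [hΦ]
    simp [V.central_K₁, V.central_K₂]

/-- bracket formulas in coordinates -/
theorem AV_bracket (V : AffineVirasoro g L) (e : ℤ → L →ₗ[ℂ] g) (δ : ℤ → L →ₗ[ℂ] ℂ)
    (eE : ∀ p m x, e p (V.E m x) = if p = m then x else 0)
    (ed : ∀ p m, e p (V.d m) = 0) (e1 : ∀ p, e p V.K₁ = 0) (e2 : ∀ p, e p V.K₂ = 0)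
    (dE : ∀ p m x, δ p (V.E m x) = 0)
    (dd : ∀ p m, δ p (V.d m) = if p = m then 1 else 0) (d1 : ∀ p, δ p V.K₁ = 0)
    (d2 : ∀ p, δ p V.K₂ = 0) :
    (∀ p m v, e p ⁅V.d m, v⁆ = ((p : ℂ) - m) • e (p - m) v) ∧
    (∀ p m v, δ p ⁅V.d m, v⁆ = ((p : ℂ) - 2 * m) * δ (p - m) v) ∧
    (∀ p m x v, e p ⁅V.E m x, v⁆ = ⁅x, e (p - m) v⁆ - ((m : ℂ) * δ (p - m) v) • x) ∧
    (∀ p m x v, δ p ⁅V.E m x, v⁆ = 0) := by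
  have ad_ap : ∀ x y : L, LieAlgebra.ad ℂ L x y = ⁅x, y⁆ := fun x y => rfl
  refine ⟨fun p m v => ?_, fun p m v => ?_, fun p m x v => ?_, fun p m x v => ?_⟩
  · have := AV_ext V (e p ∘ₗ (LieAlgebra.ad ℂ L (V.d m))) (((p : ℂ) - m) • e (p - m)) ?_ ?_ ?_ ?_
    · exact LinearMap.congr_fun this v
    · intro n y
      simp only [LinearMap.comp_apply, ad_ap, V.bracket_dE, map_smul, eE, LinearMap.smul_apply]
      by_cases h : p = m + n
      · subst h; simp
      · have : p - m ≠ n := by omega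
        simp [h, this]
    · intro n
      simp only [LinearMap.comp_apply, ad_ap, V.bracket_dd, map_add, map_smul, ed, LinearMap.smul_apply]
      split_ifs <;> simp [e2]
    · simp [V.central_K₁, e1]
    · simp [V.central_K₂, e2]
  · have := AV_ext V (δ p ∘ₗ (LieAlgebra.ad ℂ L (V.d m))) (((p : ℂ) - 2 * m) • δ (p - m)) ?_ ?_ ?_ ?_
    · exact LinearMap.congr_fun this v
    · intro n y
      simp [ad_ap, V.bracket_dE, dE]
    · intro n
      simp only [LinearMap.comp_apply, ad_ap, V.bracket_dd, map_add, map_smul, dd, LinearMap.smul_apply]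
      have h0 : δ p (if m + n = 0 then (((m : ℂ) ^ 3 - (m : ℂ)) / 12) • V.K₂ else 0) = 0 := by
        split_ifs <;> simp [d2]
      rw [h0]
      by_cases h : p = m + n
      · subst h; simp; ring
      · have : p - m ≠ n := by omega
        simp [h, this]
    · simp [V.central_K₁, d1]
    · simp [V.central_K₂, d2]
  · have := AV_ext V (e p ∘ₗ (LieAlgebra.ad ℂ L (V.E m x)))
      ((LieAlgebra.ad ℂ g x : g →ₗ[ℂ] g) ∘ₗ e (p - m) -
        (m : ℂ) • LinearMap.toSpanSingleton ℂ g x ∘ₗ δ (p - m)) ?_ ?_ ?_ ?_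
    · simpa [mul_smul] using LinearMap.congr_fun this v
    · intro n y
      have h0 : e p (if m + n = 0 then ((m : ℂ) * killingForm ℂ g x y) • V.K₁ else 0) = 0 := by
        split_ifs <;> simp [e1]
      simp only [LinearMap.comp_apply, ad_ap, V.bracket_EE, map_add, h0, eE, dE,
        LinearMap.sub_apply, LinearMap.smul_apply, map_zero]
      by_cases h : p = m + n
      · subst h; simp
      · have : p - m ≠ n := by omega
        simp [h, this]
    · intro n
      have hb : ⁅V.E m x, V.d n⁆ = -((m : ℂ) • V.E (n + m) x) := by
        rw [← lie_skew, V.bracket_dE]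
      simp only [LinearMap.comp_apply, ad_ap, hb, map_neg, map_smul, ed, eE, dd,
        LinearMap.sub_apply, LinearMap.smul_apply, map_zero]
      by_cases h : p = n + m
      · subst h; simp
      · have : p - m ≠ n := by omega
        simp [h, this]
    · simp [V.central_K₁, e1, d1]
    · simp [V.central_K₂, e2, d2]
  · have := AV_ext V (δ p ∘ₗ (LieAlgebra.ad ℂ L (V.E m x))) 0 ?_ ?_ ?_ ?_
    · exact LinearMap.congr_fun this v
    · intro n y
      simp only [LinearMap.comp_apply, ad_ap, V.bracket_EE, map_add, dE]
      split_ifs <;> simp [d1]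
    · intro n
      have hb : ⁅V.E m x, V.d n⁆ = -((m : ℂ) • V.E (n + m) x) := by
        rw [← lie_skew, V.bracket_dE]
      simp [hb, dE]
    · simp [V.central_K₁]
    · simp [V.central_K₂]

/-- the arithmetic part -/
theorem AV_arith (a : ℤ → ℂ) (k : ℤ)
    (h : ∀ m n : ℤ, ((k:ℂ) + m) * (k + n - m) * a n = (k + n) * (k + m - n) * a m) :
    ∀ n, a n = 0 := by
  by_cases hk : k = 0
  · subst hk
    intro n
    by_cases hn : n = 0
    · subst hn
      have := h 0 1
      push_cast at this
      norm_num at this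
      exact this
    · have hn' : (n : ℂ) ≠ 0 := by exact_mod_cast hn
      have h1 := h (2 * n) n
      have h2 := h (3 * n) n
      have h3 := h (3 * n) (2 * n)
      push_cast at h1 h2 h3
      have h1' : (n : ℂ) ^ 2 * (2 * a n + a (2 * n)) = 0 := by linear_combination -h1
      have h2' : (n : ℂ) ^ 2 * (3 * a n + a (3 * n)) = 0 := by linear_combination -h2 / 2
      have h3' : (n : ℂ) ^ 2 * (3 * a (2 * n) + 2 * a (3 * n)) = 0 := by linear_combination -h3
      have h4 : (n : ℂ) ^ 2 * a n = 0 := by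
        linear_combination (3 * h1' + 2 * h2' - h3') / 12
      simpa [hn'] using h4
  · have hk' : (k : ℂ) ≠ 0 := by exact_mod_cast hk
    have key : ∀ n, n ≠ 0 → a n = 0 := by
      intro n hn
      have hn' : (n : ℂ) ≠ 0 := by exact_mod_cast hn
      have h1 := h (n - k) n
      push_cast at h1
      have h2 : (n : ℂ) * k * a n = 0 := by linear_combination h1 / 2
      simpa [hn', hk'] using h2
    intro n
    by_cases hn : n = 0
    · subst hn
      have h1 := h (3 * k) 0
      rw [key (3 * k) (by omega)] at h1
      push_cast at h1
      have h2 : (k : ℂ) ^ 2 * a 0 = 0 := by linear_combination -h1 / 8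
      simpa [hk'] using h2
    · exact key n hn

theorem AV_simple [FiniteDimensional ℂ g] [LieAlgebra.IsSimple ℂ g] :
    (∀ z : g, (∀ y : g, ⁅y, z⁆ = 0) → z = 0) ∧ ∃ x y : g, killingForm ℂ g x y ≠ 0 := by
  constructor
  · intro z hz
    have : z ∈ LieAlgebra.center ℂ g := by
      rw [LieModule.mem_maxTrivSubmodule]; exact hz
    rw [LieAlgebra.center_eq_bot] at this
    simpa using this
  · by_contra! hh
    have hK : killingForm ℂ g = 0 := by ext x y; exact hh x y
    have h0 := LieAlgebra.IsKilling.ker_killingForm_eq_bot (R := ℂ) (L := g)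
    rw [hK] at h0
    apply LieAlgebra.IsSimple.non_abelian (R := ℂ) (L := g)
    have hs : ∀ x : g, x = 0 := fun x => by
      have : x ∈ LinearMap.ker (0 : g →ₗ[ℂ] g →ₗ[ℂ] ℂ) := by simp
      rw [h0] at this; simpa using this
    exact ⟨fun x y => hs _⟩
end AVProof

/-- Every symmetric biderivation of the affine-Virasoro Lie algebra is trivial. -/
theorem affineVirasoro_symmetric_biderivation_trivial (g L : Type*) [LieRing g] [LieAlgebra ℂ g] [LieAlgebra.IsSimple ℂ g] [FiniteDimensional ℂ g] [LieRing L] [LieAlgebra ℂ L] (V : AffineVirasoro g L)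
    (F : L →ₗ[ℂ] L →ₗ[ℂ] L)
    (hsymm : ∀ x y : L, F x y = F y x)
    (h1 : ∀ x y z : L, F ⁅x, y⁆ z = ⁅x, F y z⁆ - ⁅y, F x z⁆)
    (h2 : ∀ x y z : L, F x ⁅y, z⁆ = ⁅y, F x z⁆ - ⁅z, F x y⁆) :
    ∀ x y : L, F x y = 0 := by

  obtain ⟨hcen, kx, ky, hkill⟩ := AV_simple (g := g)
  obtain ⟨e, δ, eE, ed, e1, e2, dE, dd, d1, d2, hZ⟩ := AV_coords V
  obtain ⟨bde, bdd, bEe, bEd⟩ := AV_bracket V e δ eE ed e1 e2 dE dd d1 d2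
  have b0d : ∀ m, ⁅V.d 0, V.d m⁆ = (m : ℂ) • V.d m := by
    intro m; rw [V.bracket_dd]; simp
  have b0E : ∀ m x, ⁅V.d 0, V.E m x⁆ = (m : ℂ) • V.E m x := by
    intro m x; rw [V.bracket_dE]; simp
  -- basic equations
  have Q1 : ∀ (p m : ℤ) v, ((p : ℂ) - m) * δ p (F (V.d m) v)
      = ((p : ℂ) - 2 * m) * δ (p - m) (F (V.d 0) v) := by
    intro p m v
    have h := congrArg (δ p) (h1 (V.d 0) (V.d m) v)
    rw [b0d, map_sub, bdd, bdd] at h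
    simp at h
    linear_combination -h
  have Q2 : ∀ (p m : ℤ) v, ((p : ℂ) - m) • e p (F (V.d m) v)
      = ((p : ℂ) - m) • e (p - m) (F (V.d 0) v) := by
    intro p m v
    have h := congrArg (e p) (h1 (V.d 0) (V.d m) v)
    rw [b0d, map_sub, bde, bde] at h
    simp at h
    rw [sub_smul, h]; abel
  have Q3 : ∀ (p m : ℤ) x v, ((p : ℂ) - m) * δ p (F (V.E m x) v) = 0 := by
    intro p m x v
    have h := congrArg (δ p) (h1 (V.d 0) (V.E m x) v)
    rw [b0E, map_sub, bdd, bEd] at h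
    simp only [map_smul, LinearMap.smul_apply, smul_eq_mul, Int.cast_zero, mul_zero, sub_zero] at h
    linear_combination -h
  have Q4 : ∀ (p m : ℤ) x v, ((p : ℂ) - m) • e p (F (V.E m x) v)
      = ⁅x, e (p - m) (F (V.d 0) v)⁆ - ((m : ℂ) * δ (p - m) (F (V.d 0) v)) • x := by
    intro p m x v
    have h := congrArg (e p) (h1 (V.d 0) (V.E m x) v)
    rw [b0E, map_sub, bde, bEe] at h
    simp at h
    rw [sub_smul, h]; abel
  have cz : ∀ k : ℤ, k ≠ 0 → (k : ℂ) ≠ 0 := fun k hk => by exact_mod_cast hk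
  -- A = 0
  have A0 : ∀ n q, δ q (F (V.d 0) (V.d n)) = 0 := by
    intro n q
    have := AV_arith (fun n' => δ (q - n + n') (F (V.d 0) (V.d n'))) (q - n) ?_ n
    · simpa using this
    · intro m n'
      set k := q - n with hk
      have h3 := Q1 (k + m + n') m (V.d n')
      have h4 := Q1 (k + m + n') n' (V.d m)
      rw [hsymm (V.d n') (V.d m)] at h4
      rw [show k + m + n' - m = k + n' by ring] at h3
      rw [show k + m + n' - n' = k + m by ring] at h4
      push_cast at h3 h4
      linear_combination (k + n' : ℂ) * h4 - (k + m : ℂ) * h3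
  -- B = 0
  have B0 : ∀ n y q, δ q (F (V.d 0) (V.E n y)) = 0 := by
    intro n y q
    obtain ⟨m, hm1, hm2⟩ : ∃ m : ℤ, q + m - n ≠ 0 ∧ q - m ≠ 0 := by
      by_cases h : q + (q + 1) - n = 0
      · exact ⟨q + 2, by omega, by omega⟩
      · exact ⟨q + 1, h, by omega⟩
    have h3 := Q1 (q + m) m (V.E n y)
    have h4 := Q3 (q + m) n y (V.d m)
    rw [hsymm (V.E n y) (V.d m)] at h4
    rw [show q + m - m = q by ring] at h3
    have c1 := cz _ hm1
    have c2 := cz _ hm2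
    push_cast at h3 h4 c1 c2
    have h5 : ((q : ℂ) + m - n) * (q - m) * δ q (F (V.d 0) (V.E n y)) = 0 := by
      linear_combination (-(q + m - n : ℂ)) * h3 + (q : ℂ) * h4
    simpa [c1, c2] using h5
  -- relations between w and z
  have W : ∀ (k m n : ℤ) y, ((k : ℂ) + m) • ((k : ℂ) + n) • e (k + n) (F (V.d 0) (V.E n y))
      = ((k : ℂ) + n) • ⁅y, e (k + m) (F (V.d 0) (V.d m))⁆ := by
    intro k m n y
    have h3 := Q2 (k + m + n) m (V.E n y)
    have h4 := Q4 (k + m + n) n y (V.d m)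
    rw [hsymm (V.E n y) (V.d m), A0] at h4
    rw [show k + m + n - m = k + n by ring] at h3
    rw [show k + m + n - n = k + m by ring] at h4
    push_cast at h3 h4
    rw [show (k : ℂ) + m + n - m = k + n by ring] at h3
    rw [show (k : ℂ) + m + n - n = k + m by ring] at h4
    rw [← h3, smul_comm, h4]; simp
  have Zr : ∀ (k m n : ℤ), k + n ≠ 0 → k + m ≠ 0 →
      e (k + n) (F (V.d 0) (V.d n)) = e (k + m) (F (V.d 0) (V.d m)) := by
    intro k m n hn hm
    have c1 := cz _ hn
    have c2 := cz _ hm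
    have h3 := Q2 (k + m + n) m (V.d n)
    have h4 := Q2 (k + m + n) n (V.d m)
    rw [hsymm (V.d n) (V.d m)] at h4
    rw [show k + m + n - m = k + n by ring] at h3
    rw [show k + m + n - n = k + m by ring] at h4
    push_cast at h3 h4 c1 c2
    rw [show (k : ℂ) + m + n - m = k + n by ring] at h3
    rw [show (k : ℂ) + m + n - n = k + m by ring] at h4
    rw [← smul_right_injective g c1 h3, smul_right_injective g c2 h4]
  have W' : ∀ (k m n : ℤ) y, k + n ≠ 0 → ((k : ℂ) + m) • e (k + n) (F (V.d 0) (V.E n y))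
      = ⁅y, e (k + m) (F (V.d 0) (V.d m))⁆ := by
    intro k m n y hn
    have c1 := cz _ hn
    push_cast at c1
    apply smul_right_injective g c1
    have := W k m n y
    rw [smul_comm] at this
    exact this
  have w0 : ∀ (q n : ℤ) y, q ≠ 0 → e q (F (V.d 0) (V.E n y)) = 0 := by
    intro q n y hq
    have h3 := W' (q - n) (1 - (q - n)) n y (by omega)
    have h4 := W' (q - n) (2 - (q - n)) n y (by omega)
    rw [Zr (q - n) (1 - (q - n)) (2 - (q - n)) (by omega) (by omega), ← h3, ← sub_eq_zero,
      ← sub_smul] at h4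
    rw [show q - n + n = q by ring] at h4
    push_cast at h4
    rw [show (q : ℂ) - n + (2 - (q - n)) - (q - n + (1 - (q - n))) = 1 by ring] at h4
    simpa using h4
  have z0 : ∀ (q m : ℤ), e q (F (V.d 0) (V.d m)) = 0 := by
    intro q m
    apply hcen
    intro y
    have h3 := W' (q - m) m (1 - (q - m)) y (by omega)
    rw [w0 _ _ _ (by omega)] at h3
    rw [show q - m + m = q by ring] at h3
    simpa using h3.symm
  have w1 : ∀ (q n : ℤ) y, e q (F (V.d 0) (V.E n y)) = 0 := by
    intro q n y
    by_cases hq : q = 0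
    · subst hq
      by_cases hn : n = 0
      · subst hn
        apply hcen
        intro x
        have h3 := Q4 1 1 x (V.E 0 y)
        rw [B0] at h3
        simpa using h3.symm
      · have h3 := Q4 0 n y (V.d 0)
        rw [hsymm (V.E n y), z0, A0] at h3
        simpa [hn] using h3
    · exact w0 q n y hq
  -- F (d 0) v has zero coordinates
  have hK : ∀ x c : L, (∀ w : L, ⁅w, c⁆ = 0) → ∀ w : L, ⁅w, F x c⁆ = 0 := by
    intro x c hc w
    have h3 := h2 x w c
    have h4 : ⁅c, F x w⁆ = 0 := by rw [← lie_skew, hc, neg_zero]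
    rw [hc, h4] at h3
    simpa using h3.symm
  have cenZ : ∀ v : L, (∀ w : L, ⁅w, v⁆ = 0) → (∀ p, e p v = 0) ∧ (∀ p, δ p v = 0) := by
    intro v hv
    have hδ : ∀ p, δ p v = 0 := by
      intro p
      by_cases hp : p = 0
      · subst hp
        have h3 := bdd 1 1 v
        rw [hv] at h3
        norm_num at h3
        exact h3
      · have h3 := bdd p 0 v
        rw [hv] at h3
        simpa [hp] using h3
    refine ⟨fun p => hcen _ fun y => ?_, hδ⟩
    have h3 := bEe p 0 y v
    rw [hv] at h3
    simpa using h3.symm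
  have De : ∀ p v, e p (F (V.d 0) v) = 0 := by
    intro p v
    have := AV_ext V (e p ∘ₗ F (V.d 0)) 0 (fun m x => w1 p m x) (fun m => z0 p m)
      ((cenZ _ (hK _ _ V.central_K₁)).1 p) ((cenZ _ (hK _ _ V.central_K₂)).1 p)
    exact LinearMap.congr_fun this v
  have Dδ : ∀ p v, δ p (F (V.d 0) v) = 0 := by
    intro p v
    have := AV_ext V (δ p ∘ₗ F (V.d 0)) 0 (fun m x => B0 m x p) (fun m => A0 m p)
      ((cenZ _ (hK _ _ V.central_K₁)).2 p) ((cenZ _ (hK _ _ V.central_K₂)).2 p)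
    exact LinearMap.congr_fun this v
  -- off-diagonal values are central
  have cs : ∀ p m : ℤ, p ≠ m → (p : ℂ) - m ≠ 0 := by
    intro p m h; have := cz (p - m) (by omega); exact_mod_cast this
  have od : ∀ (p m : ℤ) v, p ≠ m → e p (F (V.d m) v) = 0 ∧ δ p (F (V.d m) v) = 0 := by
    intro p m v h
    have h3 := Q2 p m v
    have h4 := Q1 p m v
    rw [De] at h3
    rw [Dδ] at h4
    simpa [cs p m h] using And.intro h3 h4
  have oE : ∀ (p m : ℤ) x v, p ≠ m → e p (F (V.E m x) v) = 0 ∧ δ p (F (V.E m x) v) = 0 := by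
    intro p m x v h
    have h3 := Q4 p m x v
    have h4 := Q3 p m x v
    rw [De, Dδ] at h3
    simpa [cs p m h] using And.intro h3 h4
  have gen : ∀ (m : ℤ) v, (∀ p x, p ≠ m → e p (F x v) = 0 ∧ δ p (F x v) = 0) →
      ∀ x w : L, ⁅w, F x v⁆ = 0 := by
    intro m v hv
    have cd : ∀ n, n ≠ m → ∀ w : L, ⁅w, F (V.d n) v⁆ = 0 := by
      intro n hn
      apply hZ <;> intro p <;> by_cases hp : p = m
      · exact (od p n v (by omega)).1
      · exact (hv p _ hp).1
      · exact (od p n v (by omega)).2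
      · exact (hv p _ hp).2
    have cE : ∀ n y, n ≠ m → ∀ w : L, ⁅w, F (V.E n y) v⁆ = 0 := by
      intro n y hn
      apply hZ <;> intro p <;> by_cases hp : p = m
      · exact (oE p n y v (by omega)).1
      · exact (hv p _ hp).1
      · exact (oE p n y v (by omega)).2
      · exact (hv p _ hp).2
    have cK : ∀ c : L, (∀ w : L, ⁅w, c⁆ = 0) → ∀ w : L, ⁅w, F c v⁆ = 0 := by
      intro c hc; rw [hsymm]; exact hK v c hc
    obtain ⟨b, hb1, hb2, hb3, hb4⟩ : ∃ b : ℤ, b ≠ m ∧ b ≠ 0 ∧ m - b ≠ m ∧ b - (m - b) ≠ 0 := by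
      by_cases h : m = 1 ∨ m = 2
      · exact ⟨-1, by omega, by omega, by omega, by omega⟩
      · exact ⟨1, by omega, by omega, by omega, by omega⟩
    have cdm : ∀ w : L, ⁅w, F (V.d m) v⁆ = 0 := by
      intro w
      have h3 := h1 (V.d (m - b)) (V.d b) v
      rw [cd _ hb1, cd _ hb3, V.bracket_dd] at h3
      have c := cz _ hb4
      push_cast at c
      have h4 := congrArg (fun u => ⁅w, u⁆) h3
      rw [show m - b + b = m by ring] at h4
      split_ifs at h4
      · simpa [cK _ V.central_K₂, c] using h4
      · simpa [c] using h4
    have cEm : ∀ y, ∀ w : L, ⁅w, F (V.E m y) v⁆ = 0 := by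
      intro y w
      have h3 := h1 (V.d (m - b)) (V.E b y) v
      rw [cE _ _ hb1, cd _ hb3, V.bracket_dE] at h3
      have h4 := congrArg (fun u => ⁅w, u⁆) h3
      rw [show m - b + b = m by ring] at h4
      simpa [hb2] using h4
    intro x w
    have := AV_ext V ((LieAlgebra.ad ℂ L w : L →ₗ[ℂ] L) ∘ₗ F.flip v) 0 ?_ ?_ ?_ ?_
    · exact LinearMap.congr_fun this x
    · intro n y
      by_cases hn : n = m
      · subst hn; exact cEm y w
      · exact cE n y hn w
    · intro n
      by_cases hn : n = m
      · subst hn; exact cdm w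
      · exact cd n hn w
    · exact cK _ V.central_K₁ w
    · exact cK _ V.central_K₂ w
  have allc : ∀ x y w : L, ⁅w, F x y⁆ = 0 := by
    intro x y w
    have := AV_ext V ((LieAlgebra.ad ℂ L w : L →ₗ[ℂ] L) ∘ₗ F x) 0 ?_ ?_ ?_ ?_
    · exact LinearMap.congr_fun this y
    · intro n y
      exact gen n (V.E n y) (fun p x hp => by rw [hsymm]; exact oE p n y x hp) x w
    · intro n
      exact gen n (V.d n) (fun p x hp => by rw [hsymm]; exact od p n x hp) x w
    · exact hK x _ V.central_K₁ w
    · exact hK x _ V.central_K₂ w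
  have perf : ∀ x y z : L, F x ⁅y, z⁆ = 0 := by
    intro x y z; rw [h2, allc, allc, sub_zero]
  intro x y
  have fE : ∀ m u, F x (V.E m u) = 0 := by
    intro m u
    by_cases hm : m = 0
    · subst hm
      have h3 := perf x (V.d (-1)) (V.E 1 u)
      rw [V.bracket_dE] at h3
      simpa using h3
    · have h3 := perf x (V.d 0) (V.E m u)
      rw [b0E] at h3
      simpa [hm] using h3
  have fd : ∀ m, F x (V.d m) = 0 := by
    intro m
    by_cases hm : m = 0
    · subst hm
      have h3 := perf x (V.d (-1)) (V.d 1)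
      rw [V.bracket_dd] at h3
      norm_num at h3
      exact h3
    · have h3 := perf x (V.d 0) (V.d m)
      rw [b0d] at h3
      simpa [hm] using h3
  have := AV_ext V (F x) 0 fE fd ?_ ?_
  · exact LinearMap.congr_fun this y
  · have h3 := perf x (V.E 1 kx) (V.E (-1) ky)
    rw [V.bracket_EE, map_add, fE] at h3
    simpa [hkill] using h3
  · have h3 := perf x (V.d 2) (V.d (-2))
    rw [V.bracket_dd, map_add, map_smul, fd] at h3
    norm_num at h3
    simpa using h3
end

section
/- Let $\mathfrak{g}$ be a finite-dimensional complex simple Lie algebra. Every commutative post-Lie algebra structure on the affine-Virasoro Lie algebra $\mathfrak{L}(\mathfrak{g})$ is trivial, i.e., $x \cdot y = 0$ for all $x, y$. -/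
section Helpers

variable {g L : Type*} [LieRing g] [LieAlgebra ℂ g] [LieRing L] [LieAlgebra ℂ L]

lemma AffineVirasoro.span_ind (V : AffineVirasoro g L) (P : L → Prop)
    (h1 : P V.K₁) (h2 : P V.K₂) (hd : ∀ n, P (V.d n)) (hE : ∀ n x, P (V.E n x))
    (h0 : P 0) (hadd : ∀ x y, P x → P y → P (x + y)) (hsmul : ∀ (a : ℂ) x, P x → P (a • x)) :
    ∀ u, P u := by
  intro u
  have hu : u ∈ Submodule.span ℂ
    (({V.K₁, V.K₂} : Set L) ∪ Set.range V.d ∪ ⋃ m : ℤ, Set.range (V.E m)) := by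
    rw [V.spans]; trivial
  induction hu using Submodule.span_induction with
  | mem x hx =>
    simp only [Set.mem_union, Set.mem_insert_iff, Set.mem_singleton_iff, Set.mem_range,
      Set.mem_iUnion] at hx
    rcases hx with ((rfl | rfl) | ⟨n, rfl⟩) | ⟨n, v, rfl⟩
    · exact h1
    · exact h2
    · exact hd n
    · exact hE n v
  | zero => exact h0
  | add x y _ _ hx hy => exact hadd x y hx hy
  | smul a x _ hx => exact hsmul a x hx

/-- the parametrisation -/
noncomputable def AffineVirasoro.par (V : AffineVirasoro g L) :
    ((ℤ →₀ g) × (ℤ →₀ ℂ) × ℂ × ℂ) →ₗ[ℂ] L :=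
  LinearMap.coprod (Finsupp.lsum ℂ V.E)
    (LinearMap.coprod (Finsupp.lsum ℂ fun n => LinearMap.toSpanSingleton ℂ L (V.d n))
      (LinearMap.coprod (LinearMap.toSpanSingleton ℂ L V.K₁)
        (LinearMap.toSpanSingleton ℂ L V.K₂)))

lemma AffineVirasoro.par_apply (V : AffineVirasoro g L) (f : ℤ →₀ g) (c : ℤ →₀ ℂ) (a b : ℂ) :
    V.par (f, c, a, b) =
      (f.sum fun m x => V.E m x) + (c.sum fun m t => t • V.d m) + a • V.K₁ + b • V.K₂ := by
  simp [AffineVirasoro.par, Finsupp.lsum_apply, add_assoc]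
  rfl

lemma AffineVirasoro.par_bij (V : AffineVirasoro g L) : Function.Bijective V.par := by
  constructor
  · rw [← LinearMap.ker_eq_bot, LinearMap.ker_eq_bot']
    rintro ⟨f, c, a, b⟩ h
    rw [V.par_apply] at h
    obtain ⟨rfl, rfl, rfl, rfl⟩ := V.indep f c a b h
    rfl
  · apply V.span_ind (fun u => ∃ x, V.par x = u)
    · exact ⟨(0, 0, 1, 0), by simp [V.par_apply]⟩
    · exact ⟨(0, 0, 0, 1), by simp [V.par_apply]⟩
    · exact fun n => ⟨(0, Finsupp.single n 1, 0, 0), by simp [V.par_apply]⟩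
    · exact fun n x => ⟨(Finsupp.single n x, 0, 0, 0), by simp [V.par_apply]⟩
    · exact ⟨0, map_zero _⟩
    · rintro x y ⟨a, rfl⟩ ⟨b, rfl⟩; exact ⟨a + b, map_add _ _ _⟩
    · rintro r x ⟨a, rfl⟩; exact ⟨r • a, map_smul _ _ _⟩

lemma AffineVirasoro.exists_coord (V : AffineVirasoro g L) :
    ∃ (e : ℤ → L →ₗ[ℂ] g) (c : ℤ → L →ₗ[ℂ] ℂ),
      (∀ k n v, e k (V.E n v) = if n = k then v else 0) ∧ (∀ k n, e k (V.d n) = 0) ∧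
      (∀ k, e k V.K₁ = 0) ∧ (∀ k, e k V.K₂ = 0) ∧
      (∀ k n v, c k (V.E n v) = 0) ∧ (∀ k n, c k (V.d n) = if n = k then 1 else 0) ∧
      (∀ k, c k V.K₁ = 0) ∧ (∀ k, c k V.K₂ = 0) ∧
      (∀ u, (∀ k, e k u = 0) → (∀ k, c k u = 0) → ∃ a b : ℂ, u = a • V.K₁ + b • V.K₂) := by
  let Φ := LinearEquiv.ofBijective V.par V.par_bij
  have hE : ∀ n v, Φ.symm (V.E n v) = (Finsupp.single n v, 0, 0, 0) := by
    intro n v; rw [LinearEquiv.symm_apply_eq]; simp [Φ, V.par_apply]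
  have hd : ∀ n, Φ.symm (V.d n) = (0, Finsupp.single n 1, 0, 0) := by
    intro n; rw [LinearEquiv.symm_apply_eq]; simp [Φ, V.par_apply]
  have h1 : Φ.symm V.K₁ = (0, 0, 1, 0) := by
    rw [LinearEquiv.symm_apply_eq]; simp [Φ, V.par_apply]
  have h2 : Φ.symm V.K₂ = (0, 0, 0, 1) := by
    rw [LinearEquiv.symm_apply_eq]; simp [Φ, V.par_apply]
  refine ⟨fun k => Finsupp.lapply k ∘ₗ LinearMap.fst _ _ _ ∘ₗ Φ.symm.toLinearMap,
    fun k => Finsupp.lapply k ∘ₗ LinearMap.fst _ _ _ ∘ₗ LinearMap.snd _ _ _ ∘ₗ Φ.symm.toLinearMap,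
    ?_, ?_, ?_, ?_, ?_, ?_, ?_, ?_, ?_⟩
  · intro k n v; simp [hE, Finsupp.single_apply]
  · intro k n; simp [hd]
  · intro k; simp [h1]
  · intro k; simp [h2]
  · intro k n v; simp [hE]
  · intro k n; simp [hd, Finsupp.single_apply]
  · intro k; simp [h1]
  · intro k; simp [h2]
  · intro u hu1 hu2
    obtain ⟨⟨f, c, a, b⟩, rfl⟩ := Φ.surjective u
    simp only [LinearMap.comp_apply, LinearEquiv.coe_coe, LinearEquiv.symm_apply_apply,
      LinearMap.fst_apply, LinearMap.snd_apply, Finsupp.lapply_apply] at hu1 hu2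
    have hf : f = 0 := Finsupp.ext hu1
    have hc : c = 0 := Finsupp.ext hu2
    subst hf hc
    exact ⟨a, b, by simp [Φ, V.par_apply]⟩

/-- homogeneous generators -/
def AffineVirasoro.H (V : AffineVirasoro g L) (n : ℤ) : Set L := {V.d n} ∪ Set.range (V.E n)

lemma AffineVirasoro.perfect [LieAlgebra.IsSimple ℂ g] [FiniteDimensional ℂ g]
    (V : AffineVirasoro g L) (f : L →ₗ[ℂ] L)
    (hf : ∀ m n, ∀ x ∈ V.H m, ∀ y ∈ V.H n, f ⁅x, y⁆ = 0) : ∀ u, f u = 0 := by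
  have hdd : ∀ m n, f ⁅V.d m, V.d n⁆ = 0 := fun m n =>
    hf m n _ (Or.inl rfl) _ (Or.inl rfl)
  have hdE : ∀ m n x, f ⁅V.d m, V.E n x⁆ = 0 := fun m n x =>
    hf m n _ (Or.inl rfl) _ (Or.inr ⟨x, rfl⟩)
  have hEE : ∀ m n x y, f ⁅V.E m x, V.E n y⁆ = 0 := fun m n x y =>
    hf m n _ (Or.inr ⟨x, rfl⟩) _ (Or.inr ⟨y, rfl⟩)
  have d0 : f (V.d 0) = 0 := by
    have := hdd 1 (-1)
    rw [V.bracket_dd] at this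
    norm_num at this
    exact this
  have hE : ∀ n x, f (V.E n x) = 0 := by
    intro n x
    by_cases hn : n = 0
    · subst hn
      have := hdE 1 (-1) x
      rw [V.bracket_dE] at this
      norm_num at this
      exact this
    · have := hdE 0 n x
      rw [V.bracket_dE] at this
      simpa [hn] using this
  apply V.span_ind
  · obtain ⟨x, y, hxy⟩ : ∃ x y : g, killingForm ℂ g x y ≠ 0 := by
      by_contra! h
      have hk : killingForm ℂ g = 0 := by ext x y; simp [h]
      have hb := LieAlgebra.IsKilling.ker_killingForm_eq_bot ℂ g
      rw [hk, LinearMap.ker_zero] at hb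
      apply LieAlgebra.IsSimple.non_abelian ℂ (L := g)
      constructor
      intro x y
      have : x ∈ (⊥ : Submodule ℂ g) := by rw [← hb]; trivial
      rw [Submodule.mem_bot] at this
      simp [this]
    have := hEE 1 (-1) x y
    rw [V.bracket_EE] at this
    simpa [hE, hxy] using this
  · have := hdd 2 (-2)
    rw [V.bracket_dd] at this
    norm_num [d0] at this
    exact this
  · intro n
    by_cases hn : n = 0
    · subst hn; exact d0
    · have := hdd 0 n
      rw [V.bracket_dd] at this
      simpa [hn] using this
  · exact hE
  · simp
  · intro x y hx hy; simp [hx, hy]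
  · intro a x hx; simp [hx]

lemma lie_eq_zero_center [LieAlgebra.IsSimple ℂ g] (a : g)
    (h : ∀ y : g, ⁅a, y⁆ = 0) : a = 0 := by
  have : a ∈ LieAlgebra.center ℂ g := by
    rw [LieModule.mem_maxTrivSubmodule]
    intro y
    rw [← lie_skew, h, neg_zero]
  rw [LieAlgebra.center_eq_bot] at this
  simpa using this

lemma two_param [LieAlgebra.IsSimple ℂ g] (a : g) (c : ℂ)
    (h : ∀ (n : ℤ) (y : g), ⁅a, y⁆ + ((n : ℂ) * c) • y = 0) : a = 0 ∧ c = 0 := by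
  have ha : a = 0 := lie_eq_zero_center a (fun y => by simpa using h 0 y)
  refine ⟨ha, ?_⟩
  by_contra hc
  apply LieAlgebra.IsSimple.non_abelian ℂ (L := g)
  constructor
  intro x y
  have hy := h 1 y
  have : y = 0 := by simpa [ha, hc] using hy
  simp [this]

end Helpers

/-- Every commutative post-Lie algebra structure on the affine-Virasoro Lie algebra is trivial. -/
theorem affineVirasoro_commPostLie_trivial (g L : Type*) [LieRing g] [LieAlgebra ℂ g] [LieAlgebra.IsSimple ℂ g] [FiniteDimensional ℂ g] [LieRing L] [LieAlgebra ℂ L] (V : AffineVirasoro g L)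
    (p : L →ₗ[ℂ] L →ₗ[ℂ] L)
    (hcomm : ∀ x y : L, p x y = p y x)
    (hpost1 : ∀ x y z : L, p ⁅x, y⁆ z = p x (p y z) - p y (p x z))
    (hpost2 : ∀ x y z : L, p x ⁅y, z⁆ = ⁅p x y, z⁆ + ⁅y, p x z⁆) :
    ∀ x y : L, p x y = 0 := by
  obtain ⟨e, c, eE, ed, eK1, eK2, cE, cd, cK1, cK2, hcoord⟩ := V.exists_coord
  -- bracket formulas
  have b1 : ∀ k m (u : L), e k ⁅u, V.d m⁆ = ((m : ℂ) - k) • e (k - m) u := by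
    intro k m
    apply V.span_ind
    · rw [← lie_skew, V.central_K₁]; simp [eK1]
    · rw [← lie_skew, V.central_K₂]; simp [eK2]
    · intro n
      rw [V.bracket_dd]; split_ifs <;> simp [ed, eK2]
    · intro n x
      rw [← lie_skew, V.bracket_dE]
      simp only [map_neg, map_smul, eE]
      by_cases h : n = k - m
      · subst h; simp [← neg_smul]
      · have : ¬ (m + n = k) := by omega
        simp [h, this]
    · simp
    · intro x y hx hy; simp [hx, hy]
    · intro a x hx; simp [hx, smul_comm a]
  have b2 : ∀ k m (u : L), c k ⁅u, V.d m⁆ = (2 * (m : ℂ) - k) * c (k - m) u := by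
    intro k m
    apply V.span_ind
    · rw [← lie_skew, V.central_K₁]; simp [cK1]
    · rw [← lie_skew, V.central_K₂]; simp [cK2]
    · intro n
      have h0 : c k (if n + m = 0 then (((n : ℂ) ^ 3 - (n : ℂ)) / 12) • V.K₂ else 0) = 0 := by
        split_ifs <;> simp [cK2]
      rw [V.bracket_dd, map_add, h0]
      simp only [map_smul, cd]
      by_cases h : n = k - m
      · subst h; simp; ring
      · have : ¬ (n + m = k) := by omega
        simp [h, this]
    · intro n x
      rw [← lie_skew, V.bracket_dE]
      simp [cE]
    · simp
    · intro x y hx hy; simp [hx, hy]; ring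
    · intro a x hx; simp [hx]; ring
  have b3 : ∀ k n y (u : L), e k ⁅u, V.E n y⁆ =
      ⁅e (k - n) u, y⁆ + ((n : ℂ) * c (k - n) u) • y := by
    intro k n y
    apply V.span_ind
    · rw [← lie_skew, V.central_K₁]; simp [eK1, cK1]
    · rw [← lie_skew, V.central_K₂]; simp [eK2, cK2]
    · intro m
      rw [V.bracket_dE]
      simp only [map_smul, eE, ed, cd]
      by_cases h : m = k - n
      · subst h; simp
      · have : ¬ (m + n = k) := by omega
        simp [h, this]
    · intro m x
      have h0 : e k (if m + n = 0 then ((m : ℂ) * killingForm ℂ g x y) • V.K₁ else 0) = 0 := by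
        split_ifs <;> simp [eK1]
      rw [V.bracket_EE, map_add, h0]
      simp only [eE, cE]
      by_cases h : m = k - n
      · subst h; simp
      · have : ¬ (m + n = k) := by omega
        simp [h, this]
    · simp
    · intro u v hu hv; simp only [add_lie, map_add, hu, hv, mul_add, add_smul]; abel
    · intro a u hu
      simp only [smul_lie, map_smul, hu, smul_add, smul_smul, smul_eq_mul]
      congr 2; ring
  have b4 : ∀ k n y (u : L), c k ⁅u, V.E n y⁆ = 0 := by
    intro k n y
    apply V.span_ind
    · rw [← lie_skew, V.central_K₁]; simp
    · rw [← lie_skew, V.central_K₂]; simp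
    · intro m
      rw [V.bracket_dE]
      simp [cE]
    · intro m x
      rw [V.bracket_EE]
      split_ifs <;> simp [cE, cK1]
    · simp
    · intro u v hu hv; simp [hu, hv]
    · intro a u hu; simp [hu]
  have hcen : ∀ u, (∀ k, e k u = 0) → (∀ k, c k u = 0) → ∀ v : L, ⁅u, v⁆ = 0 := by
    intro u h1 h2 v
    obtain ⟨a, b, rfl⟩ := hcoord u h1 h2
    rw [← lie_skew, lie_add, lie_smul, lie_smul, V.central_K₁, V.central_K₂]
    simp
  -- homogeneous elements are eigenvectors
  have hdeg : ∀ n, ∀ y ∈ V.H n, ⁅V.d 0, y⁆ = (n : ℂ) • y := by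
    rintro n y (rfl | ⟨v, rfl⟩)
    · rw [V.bracket_dd]; split_ifs <;> simp
    · rw [V.bracket_dE]; simp
  -- the basic identity
  have key : ∀ x n, ∀ y ∈ V.H n, (n : ℂ) • p x y = ⁅p (V.d 0) x, y⁆ - ⁅p x y, V.d 0⁆ := by
    intro x n y hy
    have h := hpost2 x (V.d 0) y
    rw [hdeg n y hy, map_smul, hcomm x (V.d 0), ← lie_skew (V.d 0)] at h
    rw [h]; abel
  have keye : ∀ x n, ∀ y ∈ V.H n, ∀ k : ℤ, ((n : ℂ) - k) • e k (p x y) = e k ⁅p (V.d 0) x, y⁆ := by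
    intro x n y hy k
    have h := congrArg (e k) (key x n y hy)
    rw [map_sub, b1, map_smul] at h
    simp only [Int.cast_zero, zero_sub, sub_zero, neg_smul, sub_neg_eq_add] at h
    rw [sub_smul, h]; abel
  have keyc : ∀ x n, ∀ y ∈ V.H n, ∀ k : ℤ, ((n : ℂ) - k) * c k (p x y) = c k ⁅p (V.d 0) x, y⁆ := by
    intro x n y hy k
    have h := congrArg (c k) (key x n y hy)
    rw [map_sub, b2, map_smul, smul_eq_mul] at h
    simp only [Int.cast_zero, mul_zero, zero_sub, sub_zero, neg_mul, sub_neg_eq_add] at h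
    linear_combination h
  have Hd : ∀ n, V.d n ∈ V.H n := fun n => Or.inl rfl
  have HE : ∀ n v, V.E n v ∈ V.H n := fun n v => Or.inr ⟨v, rfl⟩
  -- four component identities; x arbitrary
  have k1 : ∀ x (n k : ℤ), ((k : ℂ)) • e (k + n) (p x (V.d n)) = (k : ℂ) • e k (p (V.d 0) x) := by
    intro x n k
    have h := keye x n _ (Hd n) (k + n)
    rw [b1, add_sub_cancel_right] at h
    have h2 : ((n : ℂ) - ((k + n : ℤ) : ℂ)) = -(k : ℂ) := by push_cast; ring
    rw [h2, neg_smul, neg_smul, neg_inj] at h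
    exact h
  have k2 : ∀ x (n k : ℤ), (-(k : ℂ)) * c (k + n) (p x (V.d n)) = ((n : ℂ) - k) * c k (p (V.d 0) x) := by
    intro x n k
    have h := keyc x n _ (Hd n) (k + n)
    rw [b2, add_sub_cancel_right] at h
    push_cast at h
    linear_combination h
  have k3 : ∀ x (n : ℤ) v (k : ℤ), (-(k : ℂ)) • e (k + n) (p x (V.E n v)) =
      ⁅e k (p (V.d 0) x), v⁆ + ((n : ℂ) * c k (p (V.d 0) x)) • v := by
    intro x n v k
    have h := keye x n _ (HE n v) (k + n)
    rw [b3, add_sub_cancel_right] at h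
    rw [← h]; congr 1; push_cast; ring
  have k4 : ∀ x (n : ℤ) v (k : ℤ), (-(k : ℂ)) * c (k + n) (p x (V.E n v)) = 0 := by
    intro x n v k
    have h := keyc x n _ (HE n v) (k + n)
    rw [b4] at h
    rw [← h]; push_cast; ring
  -- degree zero components of `p d0 x` vanish
  have z0 : ∀ x, e 0 (p (V.d 0) x) = 0 ∧ c 0 (p (V.d 0) x) = 0 := by
    intro x
    apply two_param
    intro n y
    rw [← k3 x n y 0]; simp
  -- w = p d0 d0 has no components in nonzero degrees
  have hw : ∀ s : ℤ, s ≠ 0 → e s (p (V.d 0) (V.d 0)) = 0 ∧ c s (p (V.d 0) (V.d 0)) = 0 := by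
    intro s hs
    have hs' : (s : ℂ) ≠ 0 := by exact_mod_cast hs
    have h1 := k1 (V.d 0) (-s) s
    have h2 := k2 (V.d 0) (-s) s
    rw [add_neg_cancel, (z0 _).1, smul_zero] at h1
    rw [add_neg_cancel, (z0 _).2, mul_zero] at h2
    constructor
    · have := h1.symm
      simpa [hs'] using this
    · have h3 : (((-s : ℤ) : ℂ) - s) ≠ 0 := by
        push_cast
        intro h
        apply hs'
        linear_combination (-1/2 : ℂ) * h
      exact (mul_eq_zero.mp h2.symm).resolve_left h3
  -- the s ≠ 0 part
  have hne : ∀ m, ∀ x ∈ V.H m, ∀ s : ℤ, s ≠ 0 →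
      e (s + m) (p (V.d 0) x) = 0 ∧ c (s + m) (p (V.d 0) x) = 0 := by
    intro m x hx s hs
    have hs' : (s : ℂ) ≠ 0 := by exact_mod_cast hs
    obtain ⟨w1, w2⟩ := hw s hs
    rcases hx with rfl | ⟨v, rfl⟩
    · have h1 := k1 (V.d 0) m s
      have h2 := k2 (V.d 0) m s
      rw [w1] at h1
      rw [w2] at h2
      exact ⟨by simpa [hs'] using h1, by simpa [hs'] using h2⟩
    · have h1 := k3 (V.d 0) m v s
      have h2 := k4 (V.d 0) m v s
      rw [w1, w2] at h1
      exact ⟨by simpa [hs'] using h1, by simpa [hs'] using h2⟩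
  -- the s = 0 part
  have cdd : ∀ m n : ℤ, n ≠ m →
      (n : ℂ) * c m (p (V.d 0) (V.d m)) = - (m : ℂ) * c n (p (V.d 0) (V.d n)) := by
    intro m n hmn
    have h1 := k2 (V.d m) n m
    have h2 := k2 (V.d n) m n
    rw [hcomm (V.d n) (V.d m), add_comm n m] at h2
    have h3 : ((n : ℂ) - m) ≠ 0 := by
      rw [sub_ne_zero]; exact_mod_cast hmn
    apply mul_left_cancel₀ h3
    linear_combination (-(n : ℂ)) * h1 + (m : ℂ) * h2
  have cd0 : ∀ m : ℤ, c m (p (V.d 0) (V.d m)) = 0 := by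
    intro m
    by_cases hm : m = 0
    · subst hm; exact (z0 _).2
    have hm' : (m : ℂ) ≠ 0 := by exact_mod_cast hm
    have h1 := cdd m (2 * m) (by omega)
    have h2 := cdd m (3 * m) (by omega)
    have h3 := cdd (2 * m) (3 * m) (by omega)
    push_cast at h1 h2 h3
    have h4 : ((m : ℂ) * m) * c m (p (V.d 0) (V.d m)) = 0 := by
      linear_combination (1/4 : ℂ) * m * h1 + (1/6 : ℂ) * m * h2 - (1/12 : ℂ) * m * h3
    simpa [hm'] using h4
  have ad0 : ∀ m n : ℤ, m ≠ 0 → n ≠ 0 →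
      e m (p (V.d 0) (V.d m)) = e n (p (V.d 0) (V.d n)) := by
    intro m n hm hn
    have hm' : (m : ℂ) ≠ 0 := by exact_mod_cast hm
    have hn' : (n : ℂ) ≠ 0 := by exact_mod_cast hn
    have h1 := k1 (V.d m) n m
    have h2 := k1 (V.d n) m n
    rw [hcomm (V.d n) (V.d m), add_comm n m] at h2
    have h1' := smul_right_injective g hm' h1
    have h2' := smul_right_injective g hn' h2
    rw [← h1', h2']
  have hT : ∀ m n : ℤ, n ≠ 0 → ∀ y, ⁅e m (p (V.d 0) (V.d m)), y⁆ =
      (-(m : ℂ)) • e n (p (V.d 0) (V.E n y)) := by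
    intro m n hn y
    have hn' : (n : ℂ) ≠ 0 := by exact_mod_cast hn
    have h1 := k3 (V.d m) n y m
    have h2 := k1 (V.E n y) m n
    rw [hcomm (V.E n y) (V.d m), add_comm n m] at h2
    have h2' := smul_right_injective g hn' h2
    rw [cd0, mul_zero, zero_smul, add_zero, h2'] at h1
    exact h1.symm
  have hT0 : ∀ n : ℤ, n ≠ 0 → ∀ y, e n (p (V.d 0) (V.E n y)) = 0 := by
    intro n hn y
    have h1 := hT 1 n hn y
    have h2 := hT 2 n hn y
    rw [ad0 2 1 (by norm_num) (by norm_num), h1, ← sub_eq_zero, ← sub_smul] at h2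
    norm_num at h2
    exact h2
  have hA0 : ∀ m : ℤ, e m (p (V.d 0) (V.d m)) = 0 := by
    intro m
    apply lie_eq_zero_center
    intro y
    rw [hT m 1 one_ne_zero, hT0 1 one_ne_zero, smul_zero]
  have hG0 : ∀ n : ℤ, n ≠ 0 → ∀ y, c n (p (V.d 0) (V.E n y)) = 0 := by
    intro n hn y
    have hn' : (n : ℂ) ≠ 0 := by exact_mod_cast hn
    have h1 := k4 (V.d (2 * n)) n y (2 * n)
    have h2 := k2 (V.E n y) (2 * n) n
    rw [hcomm (V.E n y), add_comm n (2 * n)] at h2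
    push_cast at h1 h2
    have h4 : (n : ℂ) * c n (p (V.d 0) (V.E n y)) = 0 := by
      linear_combination (1/2 : ℂ) * h1 - h2
    simpa [hn'] using h4
  have hz : ∀ m, ∀ x ∈ V.H m, e m (p (V.d 0) x) = 0 ∧ c m (p (V.d 0) x) = 0 := by
    intro m x hx
    by_cases hm : m = 0
    · subst hm; exact z0 x
    rcases hx with rfl | ⟨v, rfl⟩
    · exact ⟨hA0 m, cd0 m⟩
    · exact ⟨hT0 m hm v, hG0 m hm v⟩
  have hall : ∀ m, ∀ x ∈ V.H m, ∀ k, e k (p (V.d 0) x) = 0 ∧ c k (p (V.d 0) x) = 0 := by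
    intro m x hx k
    by_cases hk : k = m
    · subst hk; exact hz k x hx
    · have := hne m x hx (k - m) (by omega)
      simpa using this
  -- if a derivation `p x` is central-valued on homogeneous elements it vanishes
  have hvan : ∀ x, (∀ m, ∀ y ∈ V.H m, ∀ v : L, ⁅p x y, v⁆ = 0) → ∀ u, p x u = 0 := by
    intro x h
    apply V.perfect
    intro m n y hy z hz
    rw [hpost2, h m y hy, ← lie_skew, h n z hz]; simp
  have hp0 : ∀ u, p (V.d 0) u = 0 := by
    apply hvan
    intro m x hx
    exact hcen _ (fun k => (hall m x hx k).1) (fun k => (hall m x hx k).2)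
  have hcomp : ∀ x n, ∀ y ∈ V.H n, ∀ k : ℤ, k ≠ n → e k (p x y) = 0 ∧ c k (p x y) = 0 := by
    intro x n y hy k hk
    have h1 := keye x n y hy k
    have h2 := keyc x n y hy k
    have h3 : ((n : ℂ) - k) ≠ 0 := by
      rw [sub_ne_zero]; exact_mod_cast hk.symm
    rw [hp0, zero_lie, map_zero] at h1 h2
    exact ⟨by simpa [h3] using h1, by simpa [h3] using h2⟩
  have hneq : ∀ m n, m ≠ n → ∀ x ∈ V.H m, ∀ y ∈ V.H n, ∀ v : L, ⁅p x y, v⁆ = 0 := by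
    intro m n hmn x hx y hy
    have : ∀ k, e k (p x y) = 0 ∧ c k (p x y) = 0 := by
      intro k
      by_cases hk : k = n
      · rw [hcomm]; exact hcomp y m x hx k (by omega)
      · exact hcomp x n y hy k hk
    exact hcen _ (fun k => (this k).1) (fun k => (this k).2)
  have hHH : ∀ m n, ∀ x ∈ V.H m, ∀ y ∈ V.H n, ∀ v : L, ⁅p x y, v⁆ = 0 := by
    intro m n x hx y hy v
    by_cases hmn : m = n
    swap
    · exact hneq m n hmn x hx y hy v
    subst hmn
    -- choose an auxiliary index
    have hbr : ∀ i j, i ≠ m → j ≠ m → ∀ a ∈ V.H i, ∀ b ∈ V.H j, p x ⁅a, b⁆ = 0 := by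
      intro i j hi hj a ha b hb
      rw [hpost2, hneq m i hi.symm x hx a ha, ← lie_skew, hneq m j hj.symm x hx b hb]; simp
    obtain ⟨i, hi0, him, hi2⟩ : ∃ i : ℤ, i ≠ 0 ∧ i ≠ m ∧ 2 * i ≠ m := by
      by_cases h0 : m = 0
      · exact ⟨1, by omega, by omega, by omega⟩
      · exact ⟨2 * m, by omega, by omega, by omega⟩
    rcases hy with rfl | ⟨w, rfl⟩
    · by_cases h0 : m = 0
      · subst h0; rw [hcomm, hp0, zero_lie]
      · have h := hbr i (m - i) him (by omega) _ (Hd i) _ (Hd (m - i))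
        rw [V.bracket_dd, add_sub_cancel, if_neg h0, add_zero, map_smul] at h
        have h3 : (((m - i : ℤ) : ℂ) - i) ≠ 0 := by
          rw [sub_ne_zero]
          norm_cast
          omega
        have : p x (V.d m) = 0 := by
          rcases smul_eq_zero.mp h with h | h
          · exact absurd h h3
          · exact h
        rw [this, zero_lie]
    · have h := hbr i (m - i) him (by omega) _ (Hd i) _ (HE (m - i) w)
      rw [V.bracket_dE, add_sub_cancel, map_smul] at h
      have h3 : ((m - i : ℤ) : ℂ) ≠ 0 := by
        norm_cast
        omega
      have : p x (V.E m w) = 0 := by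
        rcases smul_eq_zero.mp h with h | h
        · exact absurd h h3
        · exact h
      rw [this, zero_lie]
  have hH0 : ∀ m, ∀ x ∈ V.H m, ∀ u, p x u = 0 := by
    intro m x hx
    apply hvan
    intro n y hy
    exact hHH m n x hx y hy
  intro x
  apply hvan
  intro m y hy v
  rw [hcomm, hH0 m y hy, zero_lie]
end
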